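/- Let d ≥ 2, let q ≡ 1 (mod d) be a prime power, and let χ be a multiplicative character of F_q of order exactly d. Let a_1, …, a_k be distinct elements of F_q and ε_1, …, ε_k complex d-th roots of unity. Let N be the number of x ∈ F_q with χ(x + a_i) = ε_i for all 1 ≤ i ≤ k. Then |N − q/d^k| ≤ (k − 1 − k/d + 1/d^k)·√q + k/d. -/

import Mathlib

section
open Polynomial

/-- cyclic reduction matrix -/
noncomputable def wM {R : Type*} [CommRing R] {d : ℕ} (f c : R) (B : Fin d → R) : Matrix (Fin d) (Fin d) R :=
  fun s t => (if s ≤ t then f else c) * (B (t - s))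

lemma wM_sum {R S : Type*} [CommRing R] [CommRing S] {d : ℕ} (f c : R) (B : Fin d → R)
    (φ : R →+* S) (y : S) (hy : φ f * y ^ d = φ c) (s : Fin d) :
    ∑ t, φ (wM f c B s t) * y ^ (t : ℕ) = φ f * y ^ (s : ℕ) * ∑ i, φ (B i) * y ^ (i : ℕ) := by
  have : NeZero d := ⟨by have := s.2; omega⟩
  rw [← Equiv.sum_comp (Equiv.addRight s), Finset.mul_sum]
  refine Finset.sum_congr rfl fun i _ => ?_
  have e0 : Equiv.addRight s i = i + s := rfl
  rw [e0, wM, add_sub_cancel_right, map_mul]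
  have hv := Fin.val_add i s
  have hi := i.2
  have hs := s.2
  by_cases h : (i : ℕ) + s < d
  · rw [Nat.mod_eq_of_lt h] at hv
    rw [if_pos (by rw [Fin.le_def]; omega), hv, pow_add]; ring
  · have : ((i : ℕ) + s) % d = i + s - d := by
      rw [Nat.mod_eq_sub_mod (by omega), Nat.mod_eq_of_lt (by omega)]
    rw [this] at hv
    rw [if_neg (by rw [Fin.le_def]; omega), hv, ← hy]
    have e : y ^ (i : ℕ) * y ^ (s : ℕ) = y ^ d * y ^ ((i : ℕ) + s - d) := by
      rw [← pow_add, ← pow_add]; congr 1; omega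
    linear_combination (-φ f * φ (B i)) * e

lemma minpoly_deg {K : Type*} [Field K] {ι : Type*} [Fintype ι] (a : ι → K)
    (ha : Function.Injective a) (j : ι → ℕ) (d : ℕ) (hd : 0 < d)
    (hj : ∀ r : ℕ, (∀ i, d ∣ r * j i) → d ∣ r) (f : K[X])
    (hf : f = ∏ i, (X + C (a i)) ^ (j i)) (c : K) (hc : c ≠ 0)
    (L Ω : Type*) [Field L] [Algebra K[X] L] [IsFractionRing K[X] L] [Field Ω] [Algebra L Ω]
    [IsAlgClosed Ω] [Algebra.IsAlgebraic L Ω] (y : Ω)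
    (hy : algebraMap L Ω (algebraMap K[X] L f) * y ^ d =
      algebraMap L Ω (algebraMap K[X] L (C c))) :
    d ≤ (minpoly L y).natDegree := by
  classical
  have hf0 : f ≠ 0 := by
    rw [hf]; exact Finset.prod_ne_zero_iff.2 fun i _ => pow_ne_zero _ (X_add_C_ne_zero _)
  have hfL : algebraMap K[X] L f ≠ 0 := by
    simpa using hf0
  set u : L := algebraMap K[X] L (C c) / algebraMap K[X] L f with hu
  have hyu : y ^ d = algebraMap L Ω u := by
    rw [hu, map_div₀, eq_div_iff (by simpa using hf0), mul_comm]; exact hy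
  have hint : IsIntegral L y := (Algebra.IsAlgebraic.isAlgebraic y).isIntegral
  set P := minpoly L y with hP
  have hPdvd : P ∣ X ^ d - C u := minpoly.dvd _ _ (by simp [hyu])
  set r := P.natDegree with hr
  have hsplit : (P.map (algebraMap L Ω)).Splits := IsAlgClosed.splits _
  have hmon : (P.map (algebraMap L Ω)).Monic := (minpoly.monic hint).map _
  have hroots : ∀ z ∈ (P.map (algebraMap L Ω)).roots, z ^ d = algebraMap L Ω u := by
    intro z hz
    have h1 := (mem_roots'.1 hz).2
    have h2 : (P.map (algebraMap L Ω)) ∣ (X ^ d - C u).map (algebraMap L Ω) := Polynomial.map_dvd _ hPdvd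
    have h3 := h1.dvd h2
    simpa [IsRoot, sub_eq_zero] using h3
  have hcoeff := hsplit.coeff_zero_eq_prod_roots_of_monic hmon
  have hpow : (algebraMap L Ω (P.coeff 0)) ^ d = algebraMap L Ω ((((-1) ^ r) ^ d) * u ^ r) := by
    rw [coeff_map] at hcoeff
    rw [hcoeff, mul_pow]
    have e1 := Multiset.prod_map_pow (m := (P.map (algebraMap L Ω)).roots) (f := fun z => z) (n := d)
    rw [Multiset.map_id'] at e1
    rw [← e1]
    have : (Multiset.map (fun z => z ^ d) (P.map (algebraMap L Ω)).roots) =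
        Multiset.replicate r (algebraMap L Ω u) := by
      rw [Multiset.eq_replicate]
      constructor
      · rw [Multiset.card_map, ← hsplit.natDegree_eq_card_roots, natDegree_map]
      · intro b hb
        obtain ⟨z, hz, rfl⟩ := Multiset.mem_map.1 hb
        exact hroots z hz
    rw [this, Multiset.prod_replicate, natDegree_map]
    simp only [map_mul, map_pow, map_neg, map_one, hr]
  rw [← map_pow] at hpow
  have hpow := (algebraMap L Ω).injective hpow
  obtain ⟨n, e, he, hne⟩ := IsFractionRing.div_surjective (A := K[X]) (P.coeff 0)
  have he0 : e ≠ 0 := nonZeroDivisors.ne_zero he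
  have key : n ^ d * f ^ r = C (((-1) ^ r) ^ d * c ^ r) * e ^ d := by
    apply IsFractionRing.injective K[X] L
    rw [← hne, hu] at hpow
    have heL : algebraMap K[X] L e ≠ 0 := by simpa using he0
    rw [div_pow, div_pow, mul_div_assoc', div_eq_div_iff (pow_ne_zero _ heL) (pow_ne_zero _ hfL)] at hpow
    simp only [map_mul, map_pow, map_neg, map_one] at hpow ⊢
    linear_combination hpow
  have hcc : (((-1) ^ r) ^ d * c ^ r) ≠ 0 := by simp [hc]
  have hn0 : n ≠ 0 := by
    rintro rfl
    rw [zero_pow hd.ne', zero_mul] at key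
    exact mul_ne_zero (C_ne_zero.2 hcc) (pow_ne_zero _ he0) key.symm
  have hdr : d ∣ r := by
    apply hj
    intro i
    have h1 := congrArg (rootMultiplicity (-(a i))) key
    rw [rootMultiplicity_mul (mul_ne_zero (pow_ne_zero _ hn0) (pow_ne_zero _ hf0)),
      rootMultiplicity_mul (mul_ne_zero (C_ne_zero.2 hcc) (pow_ne_zero _ he0)),
      rootMultiplicity_C, zero_add] at h1
    have hpw : ∀ (g : K[X]) (hg : g ≠ 0) (k : ℕ), rootMultiplicity (-(a i)) (g ^ k) = k * rootMultiplicity (-(a i)) g := by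
      intro g hg k
      rw [← count_roots, roots_pow, Multiset.count_nsmul, count_roots]
    rw [hpw _ hn0, hpw _ hf0, hpw _ he0] at h1
    have hfm : rootMultiplicity (-(a i)) f = j i := by
      rw [hf, ← count_roots, roots_prod _ _ (hf ▸ hf0), Multiset.count_bind]
      simp only [roots_pow, roots_X_add_C, Multiset.count_nsmul, Multiset.count_singleton]
      change ∑ b, _ = _
      rw [Finset.sum_eq_single i]
      · simp
      · intro b _ hb
        simp [fun h : a i = a b => hb (ha h).symm, ha.eq_iff, hb.symm]
      · simp
    rw [hfm] at h1
    have : d ∣ d * rootMultiplicity (-(a i)) n + r * j i := h1 ▸ dvd_mul_right _ _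
    exact (Nat.dvd_add_right (dvd_mul_right _ _)).1 this
  exact Nat.le_of_dvd (minpoly.natDegree_pos hint) hdr

end

section
open Polynomial

lemma natDegree_det_le' {K : Type*} [Field K] {d : ℕ} (M : Matrix (Fin d) (Fin d) K[X]) (N : ℕ)
    (h : ∀ s t, (M s t).natDegree ≤ N) : M.det.natDegree ≤ d * N := by
  rw [Matrix.det_apply]
  refine natDegree_sum_le_of_forall_le _ _ fun σ _ => ?_
  refine (natDegree_smul_le _ _).trans ((natDegree_prod_le _ _).trans ?_)
  refine (Finset.sum_le_card_nsmul _ _ N fun i _ => h _ _).trans ?_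
  simp

lemma stepanov_aux {K : Type*} [Field K] {d : ℕ} (hd : 0 < d) (f : K[X]) (hf0 : f ≠ 0) (c0 : K)
    (L Ω : Type*) [Field L] [Algebra K[X] L] [IsFractionRing K[X] L] [Field Ω] [Algebra L Ω]
    (y : Ω)
    (φ : K[X] →+* Ω) (hφdef : φ = (algebraMap L Ω).comp (algebraMap K[X] L))
    (hy' : φ f * y ^ d = φ (C c0))
    (hdeg : d ≤ (minpoly L y).natDegree)
    (B : Fin d → K[X]) (hB : B ≠ 0) (w : Fin d → K[X]) (hw0 : w ≠ 0)
    (hw : Matrix.vecMul w (wM f (C c0) B) = 0) : False := by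
  have hφ : Function.Injective φ := by
    rw [hφdef]
    exact (algebraMap L Ω).injective.comp (IsFractionRing.injective K[X] L)
  have hφf : φ f ≠ 0 := (map_ne_zero_iff _ hφ).2 hf0
  have hnz : ∀ v : Fin d → K[X], v ≠ 0 → ∑ i, φ (v i) * y ^ (i : ℕ) ≠ 0 := by
    intro v hv h
    let P : L[X] := ∑ i : Fin d, C (algebraMap K[X] L (v i)) * X ^ (i : ℕ)
    have hPc : ∀ i : Fin d, P.coeff i = algebraMap K[X] L (v i) := by
      intro i
      simp only [P, finsetSum_coeff, coeff_C_mul, coeff_X_pow]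
      rw [Finset.sum_eq_single i]
      · simp
      · intro b _ hb
        simp [Fin.val_inj, hb.symm]
      · simp
    have hP0 : P ≠ 0 := by
      intro h0
      apply hv
      funext i
      have := hPc i
      rw [h0, coeff_zero] at this
      exact (IsFractionRing.injective K[X] L) (by rw [← this]; simp)
    have hPy : aeval y P = 0 := by
      rw [← h]; simp [P, hφdef]
    have h1 := natDegree_le_natDegree (minpoly.degree_le_of_ne_zero L y hP0 hPy)
    have h2 : P.natDegree ≤ d - 1 := by
      refine natDegree_sum_le_of_forall_le _ _ fun i _ => ?_
      refine (natDegree_C_mul_X_pow_le _ _).trans ?_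
      have := i.2
      omega
    omega
  have hfin : ∑ s, φ (w s) * (φ f * y ^ (s : ℕ) * ∑ i, φ (B i) * y ^ (i : ℕ)) = 0 := by
    have h1 := wM_sum f (C c0) B φ y hy'
    have h3 : ∀ s : Fin d, φ (w s) * (φ f * y ^ (s : ℕ) * ∑ i, φ (B i) * y ^ (i : ℕ)) =
        ∑ t : Fin d, φ (w s) * (φ (wM f (C c0) B s t) * y ^ (t : ℕ)) := by
      intro s
      rw [← h1 s, Finset.mul_sum]
    rw [Finset.sum_congr rfl fun s _ => h3 s, Finset.sum_comm]
    refine Finset.sum_eq_zero fun t _ => ?_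
    have h2 := congrArg φ (congrFun hw t)
    simp only [Matrix.vecMul, dotProduct, Pi.zero_apply, map_zero, map_sum, map_mul] at h2
    rw [← zero_mul (y ^ (t : ℕ)), ← h2, Finset.sum_mul]
    exact Finset.sum_congr rfl fun s _ => by ring
  have : (∑ s, φ (w s) * y ^ (s : ℕ)) * (φ f * ∑ i, φ (B i) * y ^ (i : ℕ)) = 0 := by
    rw [← hfin, Finset.sum_mul]
    exact Finset.sum_congr rfl fun s _ => by ring
  rcases mul_eq_zero.1 this with h | h
  · exact hnz w hw0 h
  · exact hnz B hB ((mul_eq_zero.1 h).resolve_left hφf)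

lemma stepanov_indep {K : Type*} [Field K] {ι : Type*} [Fintype ι] (p : ℕ) [Fact p.Prime] [CharP K p]
    (a : ι → K) (ha : Function.Injective a) (ha0 : ∀ i, a i ≠ 0) (j : ι → ℕ) (d : ℕ) (hd : 0 < d)
    (hj : ∀ r : ℕ, (∀ i, d ∣ r * j i) → d ∣ r) (f : K[X])
    (hf : f = ∏ i, (X + C (a i)) ^ (j i)) (s e Q : ℕ) (hQ : Q = p ^ s) (he : Q = d * e + 1)
    (B : Fin d → K[X]) (hB : B ≠ 0) (N : ℕ) (hBN : ∀ i, (B i).natDegree ≤ N)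
    (hN : d * (f.natDegree + N) < Q) :
    ¬ (X ^ Q ∣ ∑ i, B i * (f ^ e) ^ (i : ℕ)) := by
  classical
  intro hdvd
  have hf0 : f ≠ 0 := by
    rw [hf]; exact Finset.prod_ne_zero_iff.2 fun i _ => pow_ne_zero _ (X_add_C_ne_zero _)
  set c0 : K := (f.eval 0) ^ Q with hc0
  have hc : c0 ≠ 0 := by
    apply pow_ne_zero
    rw [hf, eval_prod]
    exact Finset.prod_ne_zero_iff.2 fun i _ => by simp [ha0 i]
  set M := wM f (C c0) B with hM
  have hMdeg : ∀ s t, (M s t).natDegree ≤ f.natDegree + N := by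
    intro s t
    rw [hM, wM]
    refine natDegree_mul_le.trans (add_le_add ?_ (hBN _))
    split_ifs
    · exact le_rfl
    · simp
  -- det M ≡ 0 mod X^Q
  have hdet : X ^ Q ∣ M.det := by
    rw [← Ideal.mem_span_singleton, ← Ideal.Quotient.eq_zero_iff_mem]
    set φ := Ideal.Quotient.mk (Ideal.span {(X : K[X]) ^ Q}) with hφ
    have h1 : φ f * φ (f ^ e) ^ d = φ (C c0) := by
      rw [← map_pow, ← map_mul, hφ, Ideal.Quotient.mk_eq_mk_iff_sub_mem, Ideal.mem_span_singleton]
      have h2 : f * (f ^ e) ^ d - C c0 = (f - C (f.eval 0)) ^ Q := by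
        rw [hQ, sub_pow_char_pow, ← C_pow, ← hQ, ← hc0]
        rw [he]; ring
      rw [h2]
      apply pow_dvd_pow_of_dvd
      rw [X_dvd_iff]
      simp [coeff_zero_eq_eval_zero]
    have h3 : ∑ i, φ (B i) * φ (f ^ e) ^ (i : ℕ) = 0 := by
      have : φ (∑ i, B i * (f ^ e) ^ (i : ℕ)) = 0 := by
        rw [hφ, Ideal.Quotient.eq_zero_iff_mem, Ideal.mem_span_singleton]; exact hdvd
      simpa using this
    have h4 : (φ.mapMatrix M).mulVec (fun t => φ (f ^ e) ^ (t : ℕ)) = 0 := by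
      funext s
      have := wM_sum f (C c0) B φ (φ (f ^ e)) h1 s
      rw [h3, mul_zero] at this
      simpa [Matrix.mulVec, dotProduct] using this
    have h5 := congrArg (fun v => (φ.mapMatrix M).adjugate.mulVec v) h4
    simp only [Matrix.mulVec_mulVec, Matrix.adjugate_mul, Matrix.mulVec_zero] at h5
    have h6 := congrFun h5 ⟨0, hd⟩
    rw [Matrix.smul_mulVec, Matrix.one_mulVec] at h6
    simp only [Pi.smul_apply, pow_zero, smul_eq_mul, mul_one, Pi.zero_apply] at h6
    rw [RingHom.map_det]; exact h6
  have hdet0 : M.det = 0 := by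
    by_contra hne
    have h1 := natDegree_le_of_dvd hdet hne
    rw [natDegree_X_pow] at h1
    have h2 := natDegree_det_le' M _ hMdeg
    omega
  obtain ⟨w, hw0, hw⟩ := Matrix.exists_vecMul_eq_zero_iff.2 hdet0
  let L := FractionRing K[X]
  let Ω := AlgebraicClosure L
  let φ : K[X] →+* Ω := (algebraMap L Ω).comp (algebraMap K[X] L)
  have hφ : Function.Injective φ :=
    (algebraMap L Ω).injective.comp (IsFractionRing.injective K[X] L)
  have hφf : φ f ≠ 0 := (map_ne_zero_iff _ hφ).2 hf0
  obtain ⟨y, hy⟩ : ∃ y : Ω, y ^ d = φ (C c0) / φ f := IsAlgClosed.exists_pow_nat_eq _ hd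
  have hy' : φ f * y ^ d = φ (C c0) := by rw [hy, mul_div_cancel₀ _ hφf]
  have hdeg := minpoly_deg a ha j d hd hj f hf c0 hc L Ω y hy'
  exact stepanov_aux hd f hf0 c0 L Ω y φ rfl hy' hdeg B hB w hw0 hw

end

section
open Polynomial

lemma stepanov_G_ne_zero {K : Type*} [Field K] {ι : Type*} [Fintype ι] (p : ℕ) [Fact p.Prime] [CharP K p]
    (a : ι → K) (ha : Function.Injective a) (ha0 : ∀ i, a i ≠ 0) (j : ι → ℕ) (d : ℕ) (hd : 0 < d)
    (hj : ∀ r : ℕ, (∀ i, d ∣ r * j i) → d ∣ r) (f : K[X])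
    (hf : f = ∏ i, (X + C (a i)) ^ (j i)) (s e Q : ℕ) (hQ : Q = p ^ s) (he : Q = d * e + 1)
    (J A : ℕ) (hA : d * (f.natDegree + A) < Q)
    (b : Fin d × Fin J × Fin A → K) (hb : b ≠ 0) :
    ∑ t : Fin d × Fin J × Fin A,
      C (b t) * (X ^ (t.2.2 : ℕ) * X ^ (Q * (t.2.1 : ℕ)) * (f ^ e) ^ (t.1 : ℕ)) ≠ 0 := by
  classical
  intro h0
  let B : Fin J → Fin d → K[X] := fun jj i => ∑ k : Fin A, C (b (i, jj, k)) * X ^ (k : ℕ)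
  have hBc : ∀ jj i (k : Fin A), (B jj i).coeff k = b (i, jj, k) := by
    intro jj i k
    simp only [B, finsetSum_coeff, coeff_C_mul, coeff_X_pow]
    rw [Finset.sum_eq_single k]
    · simp
    · intro b _ hb
      simp [Fin.val_inj, hb.symm]
    · simp
  have hBd : ∀ jj i, (B jj i).natDegree ≤ A := by
    intro jj i
    refine natDegree_sum_le_of_forall_le _ _ fun k _ => ?_
    exact (natDegree_C_mul_X_pow_le _ _).trans k.2.le
  have hG : ∑ jj : Fin J, X ^ (Q * (jj : ℕ)) * ∑ i, B jj i * (f ^ e) ^ (i : ℕ) = 0 := by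
    rw [← h0, Fintype.sum_prod_type]
    simp_rw [Fintype.sum_prod_type]
    rw [Finset.sum_comm]
    refine Finset.sum_congr rfl fun jj _ => ?_
    rw [Finset.mul_sum]
    refine Finset.sum_congr rfl fun i _ => ?_
    simp only [B]
    rw [Finset.sum_mul, Finset.mul_sum]
    refine Finset.sum_congr rfl fun k _ => ?_
    ring
  have hex : ∃ n : ℕ, ∃ h : n < J, B ⟨n, h⟩ ≠ 0 := by
    by_contra hcon
    push Not at hcon
    apply hb
    funext ⟨i, jj, k⟩
    rw [← hBc, show B jj = 0 from hcon jj jj.2]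
    simp
  obtain ⟨hn, hne⟩ := Nat.find_spec hex
  set n := Nat.find hex with hndef
  have hmin : ∀ jj : Fin J, (jj : ℕ) < n → B jj = 0 := by
    intro jj hjj
    by_contra h
    exact Nat.find_min hex hjj ⟨jj.2, h⟩
  refine stepanov_indep p a ha ha0 j d hd hj f hf s e Q hQ he (B ⟨n, hn⟩) hne A (hBd _) hA ?_
  have hX : (X : K[X]) ^ (Q * n) ≠ 0 := pow_ne_zero _ X_ne_zero
  rw [← mul_dvd_mul_iff_left hX]
  rw [← Finset.add_sum_erase _ _ (Finset.mem_univ (⟨n, hn⟩ : Fin J))] at hG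
  rw [eq_neg_of_add_eq_zero_left hG, dvd_neg]
  refine Finset.dvd_sum fun jj hjj => ?_
  rcases lt_trichotomy (jj : ℕ) n with h | h | h
  · rw [hmin jj h]; simp
  · exact absurd (Fin.ext h) (Finset.ne_of_mem_erase hjj)
  · refine Dvd.dvd.mul_right ?_ _
    rw [← pow_add]
    apply pow_dvd_pow
    nlinarith

lemma stepanov_count {K : Type*} [Field K] [Fintype K] {ι : Type*} [Fintype ι]
    (p : ℕ) [Fact p.Prime] [CharP K p]
    (a : ι → K) (ha : Function.Injective a) (ha0 : ∀ i, a i ≠ 0) (j : ι → ℕ) (d : ℕ) (hd : 2 ≤ d)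
    (hj : ∀ r : ℕ, (∀ i, d ∣ r * j i) → d ∣ r) (f : K[X])
    (hf : f = ∏ i, (X + C (a i)) ^ (j i)) (s e Q : ℕ) (hQ : Q = p ^ s) (he : Q = d * e + 1)
    (s' e' Q' : ℕ) (hQ' : Q' = p ^ s') (he' : Q' = d * e' + 1)
    (hcard : Fintype.card K = Q * Q') (R : ℕ) (hR : Q' ≤ R * Q) (D C' : ℕ) (hD : f.natDegree = D)
    (hC' : C' = 2 * R * (d + 1) * (D + 1) + 1) (h1 : 2 * D + 3 ≤ e) (h2 : 2 * C' ≤ Q')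
    (c : K) (S : Finset K) (hS : ∀ x ∈ S, f.eval x ≠ 0 ∧ (f.eval x) ^ (Q' * e + e') = c) :
    S.card ≤ Q * e' + Q * (C' + D + 1) := by
  classical
  obtain ⟨A, hA⟩ : ∃ A, e = A + D + 1 := ⟨e - D - 1, by omega⟩
  obtain ⟨J, hJ⟩ : ∃ J, J = e' + C' := ⟨_, rfl⟩
  have hJQ : J ≤ Q' := by nlinarith
  have hAdeg : d * (f.natDegree + A) < Q := by rw [hD, he, hA]; nlinarith
  set n := Q' * A + J + D * Q' with hn
  have hnum : n < d * (J * A) := by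
    have e1 : Q ≤ (d + 1) * (2 * A) := by rw [he]; nlinarith
    have e2 : (D + 1) * Q' ≤ (D + 1) * (R * ((d + 1) * (2 * A))) :=
      Nat.mul_le_mul_left _ (hR.trans (Nat.mul_le_mul_left _ e1))
    have e3 : (D + 1) * (R * ((d + 1) * (2 * A))) + A = C' * A := by rw [hC']; ring
    have e4 : d * (J * A) + A = Q' * A + d * (C' * A) := by rw [hJ, he']; ring
    have e5 : 2 * (C' * A) ≤ d * (C' * A) := Nat.mul_le_mul_right _ hd
    have e6 : 0 < C' * A := Nat.mul_pos (by omega) (by omega)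
    nlinarith
  let mon : Fin d × Fin J × Fin A → K[X] := fun t =>
    X ^ (Q' * (t.2.2 : ℕ) + t.2.1) * C (c ^ (t.1 : ℕ)) * f ^ (e' * (d - 1 - t.1))
  have hmon : ∀ t, mon t ∈ degreeLT K n := by
    rintro ⟨i, jj, k⟩
    rw [mem_degreeLT]
    have hnpos : 0 < n := by have := jj.2; omega
    refine lt_of_le_of_lt degree_le_natDegree ?_
    rw [Nat.cast_lt]
    have e1 : (mon (i, jj, k)).natDegree ≤ (Q' * (k : ℕ) + jj) + 0 + e' * (d - 1 - i) * D := by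
      refine natDegree_mul_le.trans (add_le_add (natDegree_mul_le.trans (add_le_add ?_ ?_)) ?_)
      · simp
      · simp
      · exact natDegree_pow_le.trans (by rw [hD])
    have e2 : e' * (d - 1 - i) ≤ Q' := by
      rw [he']
      calc e' * (d - 1 - i) ≤ e' * d := Nat.mul_le_mul_left _ (by omega)
        _ ≤ _ := by rw [mul_comm]; omega
    have e3 : Q' * (k + 1 : ℕ) ≤ Q' * A := Nat.mul_le_mul_left _ k.2
    have e4 := Nat.mul_le_mul_right D e2
    have e5 := jj.2
    have e6 : Q' * (k + 1 : ℕ) = Q' * k + Q' := by ring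
    rw [mul_comm Q' D] at e4
    omega
  let v : Fin d × Fin J × Fin A → degreeLT K n := fun t => ⟨mon t, hmon t⟩
  have hfr : Module.finrank K (degreeLT K n) = n := by
    rw [(degreeLTEquiv K n).finrank_eq]; simp
  have hfd : Module.Finite K (degreeLT K n) := Module.Finite.equiv (degreeLTEquiv K n).symm
  have hdep : ¬ LinearIndependent K v := by
    intro hli
    have := hli.fintype_card_le_finrank
    rw [hfr] at this
    simp at this
    omega
  obtain ⟨β, hβ, t0, ht0⟩ := Fintype.not_linearIndependent_iff.1 hdep
  have hβ' : ∑ t, C (β t) * mon t = 0 := by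
    have := congrArg (Submodule.subtype _) hβ
    simpa [v, smul_eq_C_mul] using this
  let b : Fin d × Fin J × Fin A → K := fun t => β t ^ Q
  have hb : b ≠ 0 := fun h => by
    have := congrFun h t0
    exact ht0 (eq_zero_of_pow_eq_zero this)
  have hbQ : ∀ t, b t ^ Q' = β t := by
    intro t
    simp only [b]
    rw [← pow_mul, ← hcard, FiniteField.pow_card]
  set G := ∑ t : Fin d × Fin J × Fin A,
      C (b t) * (X ^ (t.2.2 : ℕ) * X ^ (Q * (t.2.1 : ℕ)) * (f ^ e) ^ (t.1 : ℕ)) with hG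
  have hG0 : G ≠ 0 := stepanov_G_ne_zero p a ha ha0 j d (by omega) hj f hf s e Q hQ he J A hAdeg b hb
  have hGdeg : G.natDegree ≤ Q * e' + Q * (C' + D + 1) := by
    refine natDegree_sum_le_of_forall_le _ _ fun t _ => ?_
    obtain ⟨i, jj, k⟩ := t
    refine (natDegree_C_mul_le _ _).trans ?_
    have e1 : (X ^ (k : ℕ) * X ^ (Q * (jj : ℕ)) * (f ^ e) ^ (i : ℕ) : K[X]).natDegree
       ≤ k + Q * jj + (i : ℕ) * (e * D) := by
      refine natDegree_mul_le.trans (add_le_add (natDegree_mul_le.trans (add_le_add ?_ ?_)) ?_)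
      · simp
      · simp
      · exact natDegree_pow_le.trans (Nat.mul_le_mul_left _ (natDegree_pow_le.trans (by rw [hD])))
    refine e1.trans ?_
    have e2 : (k : ℕ) ≤ Q := by
      have h5 := k.2
      have h6 := Nat.mul_le_mul_right e hd
      omega
    have e3 : Q * (jj : ℕ) ≤ Q * J := Nat.mul_le_mul_left _ jj.2.le
    have e4 : (i : ℕ) * (e * D) ≤ Q * D := by
      rw [← mul_assoc]
      refine Nat.mul_le_mul_right _ ?_
      rw [he]
      have := Nat.mul_le_mul_right e i.2.le
      omega
    have e5 : Q * J = Q * e' + Q * C' := by rw [hJ]; ring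
    have e6 : Q * (C' + D + 1) = Q * C' + Q * D + Q := by ring
    omega
  have hroot : ∀ x ∈ S, G.IsRoot x := by
    intro x hx
    obtain ⟨hfx, hcx⟩ := hS x hx
    have hev := congrArg (eval x) hβ'
    simp only [eval_finset_sum, eval_mul, eval_C, mon, eval_pow, eval_X, eval_zero] at hev
    set y := f.eval x with hy
    have hkey : (G.eval x) ^ Q' * y ^ (e' * (d - 1)) = 0 := by
      rw [← hev, hG, eval_finset_sum, hQ', sum_pow_char_pow, ← hQ', Finset.sum_mul]
      refine Finset.sum_congr rfl ?_
      rintro ⟨i, jj, k⟩ -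
      simp only [eval_mul, eval_C, eval_pow, eval_X, ← hy]
      rw [mul_pow, hbQ, ← hcx]
      have hxq : x ^ (Q * Q') = x := by rw [← hcard, FiniteField.pow_card]
      have e1 : (x ^ (Q * (jj : ℕ))) ^ Q' = x ^ (jj : ℕ) := by
        rw [← pow_mul, mul_right_comm, pow_mul, hxq]
      have e2 : y ^ (e' * (d - 1)) = y ^ (e' * i) * y ^ (e' * (d - 1 - i)) := by
        rw [← pow_add, ← mul_add]; congr 2; have := i.2; omega
      rw [mul_pow, mul_pow, e1, e2]
      ring
    exact eq_zero_of_pow_eq_zero ((mul_eq_zero.1 hkey).resolve_right (pow_ne_zero _ hfx))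
  calc S.card ≤ G.roots.toFinset.card := by
        apply Finset.card_le_card
        intro x hx
        rw [Multiset.mem_toFinset, mem_roots hG0]
        exact hroot x hx
    _ ≤ _ := (Multiset.toFinset_card_le _).trans ((card_roots' G).trans hGdeg)

end

section
open Polynomial

lemma pow_eq_of_modEq' {M : Type*} [Monoid M] {z : M} {d n t : ℕ} (h : z ^ d = 1) (hm : n ≡ t [MOD d]) :
    z ^ n = z ^ t := by
  rw [pow_eq_pow_mod n h, pow_eq_pow_mod t h, hm]

lemma modEq_of_pow_eq' {ζ : ℂ} {d n t : ℕ} (hd : 0 < d) (h : IsPrimitiveRoot ζ d) (hm : ζ ^ n = ζ ^ t) :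
    n ≡ t [MOD d] := by
  rw [pow_eq_pow_mod n h.pow_eq_one, pow_eq_pow_mod t h.pow_eq_one] at hm
  exact h.pow_inj (Nat.mod_lt _ hd) (Nat.mod_lt _ hd) hm

lemma mulChar_gen_primitive {K : Type*} [Field K] [Fintype K] (ψ : MulChar K ℂ) (γ : Kˣ)
    (hγ : ∀ x, x ∈ Subgroup.zpowers γ) : IsPrimitiveRoot (ψ γ) (orderOf ψ) := by
  constructor
  · rw [← MulChar.pow_apply_coe, pow_orderOf_eq_one, MulChar.one_apply_coe]
  · intro l hl
    apply orderOf_dvd_of_pow_eq_one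
    ext x
    obtain ⟨n, rfl⟩ := (mem_powers_iff_mem_zpowers.2 (hγ x))
    rw [MulChar.pow_apply_coe, MulChar.one_apply_coe]
    simp only [Units.val_pow_eq_pow_val, map_pow]
    rw [← pow_mul, mul_comm, pow_mul, hl, one_pow]

lemma char_sum_bound0 {K : Type*} [Field K] [Fintype K] {ι : Type*} [Fintype ι]
    (p : ℕ) [Fact p.Prime] [CharP K p]
    (a : ι → K) (ha : Function.Injective a) (ha0 : ∀ i, a i ≠ 0) (j : ι → ℕ) (d : ℕ) (hd : 2 ≤ d)
    (hj : ∀ r : ℕ, (∀ i, d ∣ r * j i) → d ∣ r)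
    (s e Q : ℕ) (hQ : Q = p ^ s) (he : Q = d * e + 1)
    (s' e' Q' : ℕ) (hQ' : Q' = p ^ s') (he' : Q' = d * e' + 1)
    (hcard : Fintype.card K = Q * Q') (R : ℕ) (hR : Q' ≤ R * Q) (D C' : ℕ) (hD : ∑ i, j i = D)
    (hC' : C' = 2 * R * (d + 1) * (D + 1) + 1) (h1 : 2 * D + 3 ≤ e) (h2 : 2 * C' ≤ Q')
    (ψ : MulChar K ℂ) (hψ : orderOf ψ = d) :
    ‖∑ x, ∏ i, ψ (x + a i) ^ j i‖ ≤ Q * (d * (C' + D + 1)) + Fintype.card ι := by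
  classical
  set f : K[X] := ∏ i, (X + C (a i)) ^ (j i) with hf
  have hfD : f.natDegree = D := by
    rw [hf, natDegree_prod_of_monic _ _ fun i _ => (monic_X_add_C _).pow _, ← hD]
    simp
  have hev : ∀ x, ∏ i, ψ (x + a i) ^ j i = ψ (f.eval x) := by
    intro x
    rw [hf, eval_prod, map_prod]
    simp
  simp_rw [hev]
  obtain ⟨γ, hγ⟩ := IsCyclic.exists_generator (α := Kˣ)
  set ζ : ℂ := ψ γ with hζ
  have hζp : IsPrimitiveRoot ζ d := by
    rw [← hψ, hζ]
    exact mulChar_gen_primitive ψ γ hγ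
  let S : ℕ → Finset K := fun t => Finset.univ.filter fun x => ψ (f.eval x) = ζ ^ t
  set M := Q * e' + Q * (C' + D + 1) with hM
  have hγo : (γ : K) ^ (d * (Q' * e + e')) = 1 := by
    have : d * (Q' * e + e') = Fintype.card K - 1 := by
      rw [hcard]
      have : Q * Q' = d * (Q' * e + e') + 1 := by rw [he]; nlinarith
      omega
    rw [this]; exact FiniteField.pow_card_sub_one_eq_one _ γ.ne_zero
  have hζ0 : ζ ≠ 0 := hζp.ne_zero (by omega)
  have hSM : ∀ t, (S t).card ≤ M := by
    intro t
    refine stepanov_count p a ha ha0 j d hd hj f hf s e Q hQ he s' e' Q' hQ' he' hcard R hR D C' hfD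
      hC' h1 h2 (γ ^ (t * (Q' * e + e'))) _ ?_
    intro x hx
    have hx : ψ (f.eval x) = ζ ^ t := (Finset.mem_filter.1 hx).2
    have hne : f.eval x ≠ 0 := by
      intro h0
      rw [h0, MulChar.map_zero] at hx
      exact pow_ne_zero _ hζ0 hx.symm
    refine ⟨hne, ?_⟩
    obtain ⟨n, hn⟩ := (mem_powers_iff_mem_zpowers.2 (hγ (Units.mk0 _ hne)))
    have hn' : f.eval x = (γ : K) ^ n := by
      have := congrArg Units.val hn
      simpa using this.symm
    rw [hn', map_pow, ← hζ] at hx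
    have hmod : n ≡ t [MOD d] := modEq_of_pow_eq' (by omega) hζp hx
    rw [hn', ← pow_mul]
    have h3 : n * (Q' * e + e') ≡ t * (Q' * e + e') [MOD d * (Q' * e + e')] := hmod.mul_right' _
    exact pow_eq_of_modEq' hγo h3
  -- partition
  have hpart : ∀ x, f.eval x ≠ 0 → ∃! t, t ∈ Finset.range d ∧ ψ (f.eval x) = ζ ^ t := by
    intro x hne
    obtain ⟨n, hn⟩ := (mem_powers_iff_mem_zpowers.2 (hγ (Units.mk0 _ hne)))
    have hn' : f.eval x = (γ : K) ^ n := by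
      have := congrArg Units.val hn
      simpa using this.symm
    refine ⟨n % d, ⟨Finset.mem_range.2 (Nat.mod_lt _ (by omega)), ?_⟩, ?_⟩
    · rw [hn', map_pow, ← hζ]
      exact pow_eq_pow_mod n hζp.pow_eq_one
    · rintro t ⟨ht, ht'⟩
      rw [hn', map_pow, ← hζ] at ht'
      have hmod : n ≡ t [MOD d] := modEq_of_pow_eq' (by omega) hζp ht'
      rw [hmod, Nat.mod_eq_of_lt (Finset.mem_range.1 ht)]
  have hind : ∀ (g : ℂ → ℂ), g 0 = 0 → ∑ x, g (ψ (f.eval x)) = ∑ t ∈ Finset.range d, g (ζ ^ t) * (S t).card := by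
    intro g hg
    have : ∀ t ∈ Finset.range d, g (ζ ^ t) * (S t).card = ∑ x, if ψ (f.eval x) = ζ ^ t then g (ζ ^ t) else 0 := by
      intro t _
      rw [← Finset.sum_filter, Finset.sum_const, nsmul_eq_mul, mul_comm]
    rw [Finset.sum_congr rfl this, Finset.sum_comm]
    refine Finset.sum_congr rfl fun x _ => ?_
    by_cases hne : f.eval x = 0
    · rw [hne, MulChar.map_zero, hg, Finset.sum_eq_zero]
      intro t _
      rw [if_neg (pow_ne_zero _ hζ0).symm]
    · obtain ⟨t, ⟨ht, ht'⟩, huniq⟩ := hpart x hne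
      rw [Finset.sum_eq_single t]
      · rw [if_pos ht', ht']
      · intro b hb hbt
        rw [if_neg fun h => hbt (huniq b ⟨hb, h⟩)]
      · exact fun h => absurd ht h
  have hzero : (Finset.univ.filter fun x => f.eval x = 0).card ≤ Fintype.card ι := by
    calc _ ≤ (Finset.univ.image fun i => - a i).card := by
          apply Finset.card_le_card
          intro x hx
          have hx := (Finset.mem_filter.1 hx).2
          rw [hf, eval_prod, Finset.prod_eq_zero_iff] at hx
          obtain ⟨i, _, hi⟩ := hx
          rw [eval_pow] at hi
          have := eq_zero_of_pow_eq_zero hi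
          simp at this
          exact Finset.mem_image.2 ⟨i, Finset.mem_univ _, (eq_neg_of_add_eq_zero_left this).symm⟩
      _ ≤ _ := Finset.card_image_le
  have htot : (Q * Q' : ℝ) - Fintype.card ι ≤ ∑ t ∈ Finset.range d, ((S t).card : ℝ) := by
    have e1 := hind (fun z => if z = 0 then 0 else 1) (by simp)
    simp only [pow_eq_zero_iff', hζ0, false_and, if_false, one_mul] at e1
    have e2 : ∑ x, (if ψ (f.eval x) = 0 then (0 : ℂ) else 1) = (Finset.univ.filter fun x => f.eval x ≠ 0).card := by
      rw [Finset.card_filter]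
      push_cast
      refine Finset.sum_congr rfl fun x _ => ?_
      by_cases hne : f.eval x = 0
      · rw [if_pos (by rw [hne, MulChar.map_zero]), if_neg (by simp [hne])]
      · have : ψ (f.eval x) ≠ 0 := ((isUnit_iff_ne_zero.2 hne).map ψ).ne_zero
        rw [if_neg this, if_pos hne]
    rw [e2] at e1
    have e3 : (Finset.univ.filter fun x => f.eval x ≠ 0).card = ∑ t ∈ Finset.range d, (S t).card := by
      exact_mod_cast e1
    have e4 := Finset.card_filter_add_card_filter_not (s := (Finset.univ : Finset K)) (fun x => f.eval x = 0)
    rw [Finset.card_univ, hcard] at e4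
    have e5 : Q * Q' ≤ ∑ t ∈ Finset.range d, (S t).card + Fintype.card ι := by
      rw [← e3]
      simp only [ne_eq]
      omega
    have e6 : (Q * Q' : ℝ) ≤ ∑ t ∈ Finset.range d, ((S t).card : ℝ) + Fintype.card ι := by
      exact_mod_cast e5
    linarith
  have hmain := hind (fun z => z) rfl
  have hgeom : ∑ t ∈ Finset.range d, ζ ^ t = 0 := hζp.geom_sum_eq_zero (by omega)
  have hm2 : ∑ x, ψ (f.eval x) = ∑ t ∈ Finset.range d, ζ ^ t * (((S t).card : ℂ) - M) := by
    rw [hmain]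
    simp_rw [mul_sub]
    rw [Finset.sum_sub_distrib, ← Finset.sum_mul, hgeom, zero_mul, sub_zero]
  rw [hm2]
  have hζn : ‖ζ‖ = 1 := hζp.norm'_eq_one (by omega)
  calc _ ≤ ∑ t ∈ Finset.range d, ‖ζ ^ t * (((S t).card : ℂ) - M)‖ := norm_sum_le _ _
    _ = ∑ t ∈ Finset.range d, ((M : ℝ) - (S t).card) := by
        refine Finset.sum_congr rfl fun t _ => ?_
        rw [norm_mul, norm_pow, hζn, one_pow, one_mul, norm_sub_rev]
        have : ((M : ℂ) - (S t).card) = ((M - (S t).card : ℕ) : ℂ) := by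
          rw [Nat.cast_sub (hSM t)]
        rw [this, Complex.norm_natCast, Nat.cast_sub (hSM t)]
    _ = d * M - ∑ t ∈ Finset.range d, ((S t).card : ℝ) := by
        rw [Finset.sum_sub_distrib]; simp
    _ ≤ d * M - ((Q * Q' : ℝ) - Fintype.card ι) := by linarith
    _ ≤ _ := by
        rw [hM, he']
        push_cast
        have : (0 : ℝ) ≤ Q := Nat.cast_nonneg _
        nlinarith

lemma char_sum_bound {K : Type*} [Field K] [Fintype K] {ι : Type*} [Fintype ι]
    (p : ℕ) [Fact p.Prime] [CharP K p]
    (a : ι → K) (ha : Function.Injective a) (hK : Fintype.card ι < Fintype.card K) (j : ι → ℕ)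
    (d : ℕ) (hd : 2 ≤ d)
    (hj : ∀ r : ℕ, (∀ i, d ∣ r * j i) → d ∣ r)
    (s e Q : ℕ) (hQ : Q = p ^ s) (he : Q = d * e + 1)
    (s' e' Q' : ℕ) (hQ' : Q' = p ^ s') (he' : Q' = d * e' + 1)
    (hcard : Fintype.card K = Q * Q') (R : ℕ) (hR : Q' ≤ R * Q) (D C' : ℕ) (hD : ∑ i, j i = D)
    (hC' : C' = 2 * R * (d + 1) * (D + 1) + 1) (h1 : 2 * D + 3 ≤ e) (h2 : 2 * C' ≤ Q')
    (ψ : MulChar K ℂ) (hψ : orderOf ψ = d) :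
    ‖∑ x, ∏ i, ψ (x + a i) ^ j i‖ ≤ Q * (d * (C' + D + 1)) + Fintype.card ι := by
  classical
  obtain ⟨t, ht⟩ : ∃ t : K, ∀ i, t + a i ≠ 0 := by
    by_contra hcon
    push Not at hcon
    choose g hg using hcon
    have : Function.Injective g := by
      intro x y hxy
      have h1 := hg x
      rw [hxy, ← hg y] at h1
      exact add_right_cancel h1
    exact absurd (Fintype.card_le_of_injective g this) (by omega)
  rw [← Equiv.sum_comp (Equiv.addRight t)]
  have := char_sum_bound0 p (fun i => t + a i) (fun x y h => ha (add_left_cancel h)) ht j d hd hj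
    s e Q hQ he s' e' Q' hQ' he' hcard R hR D C' hD hC' h1 h2 ψ hψ
  simpa [add_assoc] using this

end

section
open Polynomial UniqueFactorizationMonoid

lemma finite_monics (F : Type*) [Field F] [Fintype F] (n : ℕ) :
    {g : F[X] | g.Monic ∧ g.natDegree = n}.Finite := by
  have h1 : Finite (degreeLT F (n + 1)) := Finite.of_equiv _ (degreeLTEquiv F (n + 1)).symm.toEquiv
  refine Set.Finite.subset (Set.toFinite (degreeLT F (n + 1) : Set F[X])) ?_
  rintro g ⟨hg, hn⟩
  rw [SetLike.mem_coe, mem_degreeLT, degree_eq_natDegree hg.ne_zero, hn]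
  exact_mod_cast Nat.lt_succ_self n

/-- monic polynomials of degree n -/
noncomputable def monics (F : Type*) [Field F] [Fintype F] (n : ℕ) : Finset F[X] :=
  (finite_monics F n).toFinset

lemma mem_monics {F : Type*} [Field F] [Fintype F] {n : ℕ} {g : F[X]} :
    g ∈ monics F n ↔ g.Monic ∧ g.natDegree = n := by
  simp [monics]

/-- the characteristic polynomial, as power of minimal polynomial -/
noncomputable def cpol (F : Type*) {E : Type*} [Field F] [Field E] [Algebra F E] (x : E) : F[X] :=
  minpoly F x ^ (Module.finrank F E / (minpoly F x).natDegree)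

section
variable {F E : Type*} [Field F] [Fintype F] [Field E] [Fintype E] [Algebra F E]

lemma minpoly_natDegree_dvd (x : E) : (minpoly F x).natDegree ∣ Module.finrank F E := by
  have : Module.Finite F E := Module.Finite.of_finite
  exact minpoly.degree_dvd (Algebra.IsIntegral.isIntegral x)

lemma cpol_monic (x : E) : (cpol F x).Monic := by
  have : Module.Finite F E := Module.Finite.of_finite
  exact (minpoly.monic (Algebra.IsIntegral.isIntegral x)).pow _

lemma cpol_natDegree (x : E) : (cpol F x).natDegree = Module.finrank F E := by
  rw [cpol, natDegree_pow, Nat.div_mul_cancel (minpoly_natDegree_dvd x)]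

lemma card_minpoly_eq [DecidableEq F[X]] (P : F[X]) (hP : P.Monic) (hirr : Irreducible P) :
    (Finset.univ.filter fun x : E => minpoly F x = P).card =
      if P.natDegree ∣ Module.finrank F E then P.natDegree else 0 := by
  classical
  have hfin : Module.Finite F E := Module.Finite.of_finite
  split_ifs with h
  · have : Fact (Irreducible P) := ⟨hirr⟩
    have hfr : Module.finrank F (AdjoinRoot P) = P.natDegree := by
      rw [(AdjoinRoot.powerBasis hirr.ne_zero).finrank, AdjoinRoot.powerBasis_dim]
    have h1 := FiniteField.natCard_algHom_of_finrank_dvd (F := F) (K := AdjoinRoot P) (L := E) (by rw [hfr]; exact h)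
    rw [hfr, Nat.card_congr (AdjoinRoot.equiv E F P hirr.ne_zero)] at h1
    rw [← h1, ← Fintype.card_subtype, Fintype.card_eq_nat_card]
    apply Nat.card_congr
    apply Equiv.subtypeEquivRight
    intro x
    rw [mem_aroots]
    constructor
    · intro hx
      exact ⟨hirr.ne_zero, by rw [← hx]; exact minpoly.aeval _ _⟩
    · rintro ⟨_, hx⟩
      exact (minpoly.eq_of_irreducible_of_monic hirr hx hP).symm
  · rw [Finset.card_eq_zero, Finset.filter_eq_empty_iff]
    rintro x - rfl
    exact h (minpoly_natDegree_dvd x)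

open Classical in
lemma card_cpol_dvd (g : F[X]) (hg : g ≠ 0) :
    (Nat.card {x : E // cpol F x ∣ g}) =
      ∑ P ∈ (normalizedFactors g).toFinset,
        if P.natDegree ∣ Module.finrank F E ∧ P ^ (Module.finrank F E / P.natDegree) ∣ g then P.natDegree else 0 := by
  classical
  have hfin : Module.Finite F E := Module.Finite.of_finite
  rw [Nat.card_eq_fintype_card, Fintype.card_subtype]
  rw [Finset.card_eq_sum_card_fiberwise (f := fun x : E => minpoly F x) (t := (normalizedFactors g).toFinset)]
  · refine Finset.sum_congr rfl fun P hP => ?_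
    rw [Multiset.mem_toFinset] at hP
    have hirr := irreducible_of_normalized_factor P hP
    have hmon : P.Monic := by
      have := normalize_normalized_factor P hP
      rw [← this]; exact monic_normalize hirr.ne_zero
    by_cases h2 : P ^ (Module.finrank F E / P.natDegree) ∣ g
    · simp only [h2, and_true]
      rw [← card_minpoly_eq (E := E) P hmon hirr, Finset.filter_filter]
      congr 1
      ext x
      simp only [Finset.mem_filter, Finset.mem_univ, true_and]
      constructor
      · exact fun h => h.2
      · intro h
        refine ⟨?_, h⟩
        rw [cpol, h]; exact h2
    · simp only [h2, and_false, if_false]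
      rw [Finset.card_eq_zero, Finset.filter_eq_empty_iff]
      intro x hx h
      have := (Finset.mem_filter.1 hx).2
      rw [cpol, h] at this
      exact h2 this
  · intro x hx
    have hx := (Finset.mem_filter.1 hx).2
    rw [Finset.mem_coe, Multiset.mem_toFinset]
    have hirr := minpoly.irreducible (Algebra.IsIntegral.isIntegral (R := F) x)
    have hdvd : minpoly F x ∣ g := by
      refine dvd_trans (dvd_pow_self _ ?_) hx
      have h1 : 0 < Module.finrank F E := Module.finrank_pos
      have h2 := Nat.div_pos (Nat.le_of_dvd h1 (minpoly_natDegree_dvd (F := F) x)) hirr.natDegree_pos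
      exact h2.ne'
    rw [mem_normalizedFactors_iff' hg]
    exact ⟨hirr, (minpoly.monic (Algebra.IsIntegral.isIntegral x)).normalize_eq_self, hdvd⟩
end

section
variable {F : Type*} [Field F] [Fintype F] (K : ℕ → Type*) [∀ r, Field (K r)] [∀ r, Fintype (K r)]
  [∀ r, Algebra F (K r)]

lemma card_mult (g : F[X]) (hg : g.Monic) (n : ℕ) (hn : g.natDegree = n)
    (hK : ∀ r, Module.finrank F (K r) = r + 1) :
    ∑ r ∈ Finset.range n, Nat.card {x : K r // cpol F x ∣ g} = n := by
  classical
  simp_rw [card_cpol_dvd g hg.ne_zero, hK]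
  rw [Finset.sum_comm]
  have h1 : ∀ P ∈ (normalizedFactors g).toFinset,
      ∑ r ∈ Finset.range n, (if P.natDegree ∣ r + 1 ∧ P ^ ((r + 1) / P.natDegree) ∣ g then P.natDegree else 0)
        = (normalizedFactors g).count P • P.natDegree := by
    intro P hP
    rw [Multiset.mem_toFinset] at hP
    have hirr := irreducible_of_normalized_factor P hP
    have hδ := hirr.natDegree_pos
    rw [← Finset.sum_filter, Finset.sum_const]
    congr 1
    have hcount : ∀ s, P ^ s ∣ g ↔ s ≤ (normalizedFactors g).count P := by
      intro s
      rw [pow_dvd_iff_le_emultiplicity, emultiplicity_eq_count_normalizedFactors hirr hg.ne_zero,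
        normalize_normalized_factor P hP]
      exact Nat.cast_le
    have hIcc : (Finset.Icc 1 ((normalizedFactors g).count P)).card = (normalizedFactors g).count P := by
      simp
    refine Eq.trans ?_ hIcc
    symm
    refine Finset.card_bij (fun s _ => s * P.natDegree - 1) ?_ ?_ ?_
    · intro s hs
      rw [Finset.mem_Icc] at hs
      have h2 : 0 < s * P.natDegree := Nat.mul_pos (by omega) hδ
      have h3 : s * P.natDegree - 1 + 1 = s * P.natDegree := by omega
      have h4 : P ^ s ∣ g := (hcount s).2 hs.2
      have h5 := natDegree_le_of_dvd h4 hg.ne_zero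
      rw [natDegree_pow] at h5
      rw [Finset.mem_filter, Finset.mem_range, h3]
      refine ⟨by omega, dvd_mul_left _ _, ?_⟩
      rw [Nat.mul_div_cancel _ hδ]; exact h4
    · intro s hs t ht hst
      rw [Finset.mem_Icc] at hs ht
      have h2 : 0 < s * P.natDegree := Nat.mul_pos (by omega) hδ
      have h3 : 0 < t * P.natDegree := Nat.mul_pos (by omega) hδ
      have h4 : s * P.natDegree = t * P.natDegree := by omega
      exact Nat.eq_of_mul_eq_mul_right hδ h4
    · intro r hr
      rw [Finset.mem_filter, Finset.mem_range] at hr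
      obtain ⟨hr1, hr2, hr3⟩ := hr
      refine ⟨(r + 1) / P.natDegree, ?_, ?_⟩
      · rw [Finset.mem_Icc]
        exact ⟨Nat.div_pos (Nat.le_of_dvd (by omega) hr2) hδ, (hcount _).1 hr3⟩
      · rw [Nat.div_mul_cancel hr2]; omega
  rw [Finset.sum_congr rfl h1, ← Finset.sum_multiset_map_count]
  have h2 : (normalizedFactors g).prod = g := by
    have := prod_normalizedFactors_eq hg.ne_zero
    rw [this, hg.normalize_eq_self]
  rw [← hn]
  conv_rhs => rw [← h2]
  rw [natDegree_multiset_prod]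
  exact zero_notMem_normalizedFactors g

lemma newton (lam : F[X] → ℂ) (hlam : ∀ g h : F[X], g.Monic → h.Monic → lam (g * h) = lam g * lam h)
    (hK : ∀ r, Module.finrank F (K r) = r + 1) (n : ℕ) :
    (n : ℂ) * ∑ g ∈ monics F n, lam g =
      ∑ r ∈ Finset.range n, (∑ x : K r, lam (cpol F x)) * ∑ g ∈ monics F (n - 1 - r), lam g := by
  classical
  have h1 : (n : ℂ) * ∑ g ∈ monics F n, lam g =
      ∑ g ∈ monics F n, ∑ r ∈ Finset.range n, ∑ x : K r, if cpol F x ∣ g then lam g else 0 := by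
    rw [Finset.mul_sum]
    refine Finset.sum_congr rfl fun g hg => ?_
    obtain ⟨hg1, hg2⟩ := mem_monics.1 hg
    have := card_mult K g hg1 n hg2 hK
    have hcast : (n : ℂ) = ∑ r ∈ Finset.range n, (Nat.card {x : K r // cpol F x ∣ g} : ℂ) := by
      exact_mod_cast this.symm
    conv_lhs => rw [hcast]
    rw [Finset.sum_mul]
    refine Finset.sum_congr rfl fun r _ => ?_
    rw [← Finset.sum_filter, Finset.sum_const, nsmul_eq_mul, Nat.card_eq_fintype_card, Fintype.card_subtype]
  rw [h1, Finset.sum_comm]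
  refine Finset.sum_congr rfl fun r hr => ?_
  rw [Finset.sum_comm, Finset.sum_mul]
  refine Finset.sum_congr rfl fun x _ => ?_
  rw [← Finset.sum_filter, Finset.mul_sum]
  symm
  have hcd : (cpol F x).natDegree = r + 1 := by rw [cpol_natDegree, hK]
  have hr := Finset.mem_range.1 hr
  refine Finset.sum_bij (fun h _ => cpol F x * h) ?_ ?_ ?_ ?_
  · intro h hh
    obtain ⟨hh1, hh2⟩ := mem_monics.1 hh
    rw [Finset.mem_filter, mem_monics, (cpol_monic x).natDegree_mul hh1]
    exact ⟨⟨(cpol_monic x).mul hh1, by omega⟩, dvd_mul_right _ _⟩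
  · intro h _ h' _ hhh
    exact mul_left_cancel₀ (cpol_monic x).ne_zero hhh
  · intro g hg
    rw [Finset.mem_filter, mem_monics] at hg
    obtain ⟨⟨hg1, hg2⟩, h, rfl⟩ := hg
    have hh1 : h.Monic := (cpol_monic x).of_mul_monic_left hg1
    refine ⟨h, ?_, rfl⟩
    rw [(cpol_monic x).natDegree_mul hh1] at hg2
    rw [mem_monics]
    exact ⟨hh1, by omega⟩
  · intro h hh
    rw [hlam _ _ (cpol_monic x) (mem_monics.1 hh).1]
end

end

section
open Polynomial

section
variable {F : Type*} [Field F] [Fintype F] {ι : Type*} [Fintype ι]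

/-- the multiplicative function -/
noncomputable def lamb (χ : MulChar F ℂ) (a : ι → F) (j : ι → ℕ) (g : F[X]) : ℂ :=
  ∏ i, χ ((-1) ^ g.natDegree * g.eval (-a i)) ^ j i

lemma lamb_mul (χ : MulChar F ℂ) (a : ι → F) (j : ι → ℕ) (g h : F[X]) (hg : g.Monic) (hh : h.Monic) :
    lamb χ a j (g * h) = lamb χ a j g * lamb χ a j h := by
  unfold lamb
  rw [← Finset.prod_mul_distrib]
  refine Finset.prod_congr rfl fun i _ => ?_
  rw [← mul_pow, ← map_mul, hg.natDegree_mul hh, eval_mul, pow_add]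
  congr 2
  ring

lemma monics_zero : monics F 0 = {1} := by
  ext g
  rw [mem_monics, Finset.mem_singleton]
  constructor
  · rintro ⟨h1, h2⟩
    exact h1.natDegree_eq_zero.1 h2
  · rintro rfl
    exact ⟨monic_one, natDegree_one⟩

lemma sum_lamb_zero (χ : MulChar F ℂ) (a : ι → F) (j : ι → ℕ) :
    ∑ g ∈ monics F 0, lamb χ a j g = 1 := by
  rw [monics_zero, Finset.sum_singleton]
  simp [lamb]

lemma sum_lamb_one (χ : MulChar F ℂ) (a : ι → F) (j : ι → ℕ) :
    ∑ g ∈ monics F 1, lamb χ a j g = ∑ x, ∏ i, χ (x + a i) ^ j i := by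
  symm
  refine Finset.sum_bij (fun x _ => X - C x) ?_ ?_ ?_ ?_
  · intro x _
    rw [mem_monics]
    exact ⟨monic_X_sub_C x, natDegree_X_sub_C x⟩
  · intro x _ y _ h
    simpa using h
  · intro g hg
    obtain ⟨h1, h2⟩ := mem_monics.1 hg
    refine ⟨-g.coeff 0, Finset.mem_univ _, ?_⟩
    have := h1.eq_X_add_C h2
    conv_rhs => rw [this]
    simp
  · intro x _
    unfold lamb
    refine Finset.prod_congr rfl fun i _ => ?_
    congr 2
    simp

lemma sum_lamb_large (χ : MulChar F ℂ) (a : ι → F) (ha : Function.Injective a) (j : ι → ℕ)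
    (i0 : ι) (hi0 : χ ^ j i0 ≠ 1) (n : ℕ) (hn : Fintype.card ι ≤ n) :
    ∑ g ∈ monics F n, lamb χ a j g = 0 := by
  classical
  set h : F[X] := Lagrange.basis Finset.univ (fun i => - a i) i0 with hh
  have hinj : Set.InjOn (fun i => - a i) (Finset.univ : Finset ι) := by
    intro x _ y _ hxy
    exact ha (neg_injective hxy)
  have h1 : h.eval (- a i0) = 1 := Lagrange.eval_basis_self hinj (Finset.mem_univ _)
  have h0 : ∀ i, i ≠ i0 → h.eval (- a i) = 0 := fun i hi =>
    Lagrange.eval_basis_of_ne (v := fun i => - a i) hi.symm (Finset.mem_univ _)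
  have hcard : 0 < Fintype.card ι := Fintype.card_pos_iff.2 ⟨i0⟩
  have hdeg : h.degree < n := by
    rw [hh, Lagrange.degree_basis hinj (Finset.mem_univ _), Finset.card_univ]
    exact_mod_cast (by omega)
  have hdegt : ∀ t, (C t * h).degree < (n : WithBot ℕ) := by
    intro t
    rw [← smul_eq_C_mul]
    exact lt_of_le_of_lt (degree_smul_le t h) hdeg
  have hmon : ∀ t, ∀ g ∈ monics F n, g + C t * h ∈ monics F n := by
    intro t g hg
    obtain ⟨hg1, hg2⟩ := mem_monics.1 hg
    have hlt : (C t * h).degree < g.degree := by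
      rw [degree_eq_natDegree hg1.ne_zero, hg2]; exact hdegt t
    rw [mem_monics]
    exact ⟨hg1.add_of_left hlt, by rw [natDegree_add_eq_left_of_degree_lt hlt, hg2]⟩
  have hshift : ∀ t, ∑ g ∈ monics F n, lamb χ a j (g + C t * h) = ∑ g ∈ monics F n, lamb χ a j g := by
    intro t
    refine Finset.sum_bij' (fun g _ => g + C t * h) (fun g _ => g + C (-t) * h) ?_ ?_ ?_ ?_ ?_
    · exact hmon t
    · exact hmon (-t)
    · intro g _; simp
    · intro g _; simp
    · intro g _; rfl
  have hsum : ∀ g ∈ monics F n, ∑ t : F, lamb χ a j (g + C t * h) = 0 := by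
    intro g hg
    have hd := fun t => (mem_monics.1 (hmon t g hg)).2
    have h2 : ∀ t, lamb χ a j (g + C t * h) =
        (∏ i ∈ Finset.univ.erase i0, χ ((-1) ^ n * g.eval (-a i)) ^ j i) *
        (χ ((-1) ^ n) ^ j i0 * χ (g.eval (- a i0) + t) ^ j i0) := by
      intro t
      unfold lamb
      rw [hd t, ← Finset.mul_prod_erase _ _ (Finset.mem_univ i0), mul_comm]
      congr 1
      · refine Finset.prod_congr rfl fun i hi => ?_
        simp [h0 i (Finset.ne_of_mem_erase hi)]
      · rw [← mul_pow, ← map_mul]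
        simp [h1]
    simp_rw [h2, ← Finset.mul_sum]
    have h3 : ∑ t, χ (g.eval (- a i0) + t) ^ j i0 = 0 := by
      have h4 : ∑ t, χ (g.eval (- a i0) + t) ^ j i0 = ∑ t, χ t ^ j i0 :=
        Fintype.sum_equiv (Equiv.addLeft (g.eval (- a i0))) _ _ (fun t => rfl)
      rw [h4]
      have h5 := MulChar.sum_eq_zero_of_ne_one hi0
      have h6 : j i0 ≠ 0 := by
        intro h; rw [h, pow_zero] at hi0; exact hi0 rfl
      rw [← h5]
      exact Finset.sum_congr rfl fun t _ => (MulChar.pow_apply' χ h6 t).symm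
    rw [h3]; simp
  have h7 : (Fintype.card F : ℂ) * ∑ g ∈ monics F n, lamb χ a j g = 0 := by
    have : ∑ t : F, ∑ g ∈ monics F n, lamb χ a j (g + C t * h) = 0 := by
      rw [Finset.sum_comm]; exact Finset.sum_eq_zero hsum
    simp_rw [hshift] at this
    simpa using this
  rcases mul_eq_zero.1 h7 with h8 | h8
  · exact absurd h8 (by exact_mod_cast Fintype.card_ne_zero)
  · exact h8
end

end

section
open Polynomial

section
variable {F E : Type*} [Field F] [Fintype F] [Field E] [Fintype E] [Algebra F E] {ι : Type*} [Fintype ι]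

lemma norm_eq_minpoly (y : E) : Algebra.norm F y =
    ((-1) ^ (minpoly F y).natDegree * (minpoly F y).coeff 0) ^ (Module.finrank F E / (minpoly F y).natDegree) := by
  have hfin : Module.Finite F E := Module.Finite.of_finite
  have hint : IsIntegral F y := Algebra.IsIntegral.isIntegral y
  rw [Algebra.norm_eq_norm_adjoin]
  have h1 := Algebra.PowerBasis.norm_gen_eq_coeff_zero_minpoly (IntermediateField.adjoin.powerBasis hint)
  rw [IntermediateField.adjoin.powerBasis_gen, IntermediateField.adjoin.powerBasis_dim,
    IntermediateField.minpoly_gen] at h1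
  rw [h1]
  congr 1
  have h2 := Module.finrank_mul_finrank F (IntermediateField.adjoin F {y}) E
  rw [IntermediateField.adjoin.finrank hint] at h2
  rw [← h2, Nat.mul_div_cancel_left _ (minpoly.natDegree_pos hint)]

lemma norm_cpol (x : E) (b : F) :
    (-1) ^ (cpol F x).natDegree * (cpol F x).eval (-b) = Algebra.norm F (x + algebraMap F E b) := by
  rw [norm_eq_minpoly, minpoly.add_algebraMap, natDegree_comp, natDegree_X_sub_C, mul_one,
    coeff_zero_eq_eval_zero, eval_comp]
  rw [cpol, natDegree_pow, eval_pow]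
  simp only [eval_sub, eval_X, eval_C, zero_sub]
  rw [mul_pow, ← pow_mul, mul_comm (Module.finrank F E / (minpoly F x).natDegree)]

/-- composition of a character with the norm -/
noncomputable def normChar (E : Type*) [Field E] [Fintype E] [Algebra F E] (χ : MulChar F ℂ) : MulChar E ℂ where
  toMonoidHom := χ.toMonoidHom.comp (Algebra.norm F)
  map_nonunit' := by
    intro x hx
    have : x = 0 := by simpa using hx
    subst this
    have hfin : Module.Finite F E := Module.Finite.of_finite
    change χ (Algebra.norm F (0 : E)) = 0
    rw [Algebra.norm_zero]
    exact χ.map_zero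

lemma normChar_apply (χ : MulChar F ℂ) (x : E) : normChar E χ x = χ (Algebra.norm F x) := rfl

lemma normChar_pow_eq_one (χ : MulChar F ℂ) (n : ℕ) : normChar E χ ^ n = 1 ↔ χ ^ n = 1 := by
  have hfin : Module.Finite F E := Module.Finite.of_finite
  constructor
  · intro h
    ext u
    obtain ⟨v, hv⟩ := FiniteField.unitsMap_norm_surjective F E u
    have h1 := congrArg (fun ψ : MulChar E ℂ => ψ v) h
    simp only [MulChar.pow_apply_coe, MulChar.one_apply_coe, normChar_apply] at h1
    rw [MulChar.pow_apply_coe, MulChar.one_apply_coe, ← hv]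
    exact h1
  · intro h
    ext v
    have h1 := congrArg (fun ψ : MulChar F ℂ => ψ (Units.map (Algebra.norm F) v : Fˣ)) h
    simp only [MulChar.pow_apply_coe, MulChar.one_apply_coe] at h1
    rw [MulChar.pow_apply_coe, MulChar.one_apply_coe, normChar_apply]
    exact h1

lemma orderOf_normChar (χ : MulChar F ℂ) : orderOf (normChar E χ) = orderOf χ :=
  orderOf_eq_orderOf_iff.2 (normChar_pow_eq_one χ)

lemma lamb_cpol (χ : MulChar F ℂ) (a : ι → F) (j : ι → ℕ) (x : E) :
    lamb χ a j (cpol F x) = ∏ i, normChar E χ (x + algebraMap F E (a i)) ^ j i := by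
  unfold lamb
  refine Finset.prod_congr rfl fun i _ => ?_
  rw [norm_cpol, normChar_apply]

end

end

section
open Polynomial

lemma S_bound {F : Type*} [Field F] [Fintype F] (p : ℕ) [Fact p.Prime] [CharP F p]
    {ι : Type*} [Fintype ι] (K : ℕ → Type*) [∀ r, Field (K r)] [∀ r, Fintype (K r)]
    [∀ r, Algebra F (K r)] (hK : ∀ r, Module.finrank F (K r) = r + 1)
    (a : ι → F) (ha : Function.Injective a) (j : ι → ℕ) (d : ℕ) (hd : 2 ≤ d)
    (hj : ∀ r : ℕ, (∀ i, d ∣ r * j i) → d ∣ r) (hq : Fintype.card F % d = 1)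
    (χ : MulChar F ℂ) (hχ : orderOf χ = d) :
    ∃ A : ℝ, ∀ r, ‖∑ x : K r, lamb χ a j (cpol F x)‖ ≤ A * Real.sqrt (Fintype.card F) ^ r := by
  set q := Fintype.card F with hqdef
  obtain ⟨s0, hs0⟩ : ∃ s0 : ℕ, q = p ^ s0 := by
    obtain ⟨m, _, hm⟩ := FiniteField.card F p
    exact ⟨m, hm⟩
  have hq1 : 1 < q := Fintype.one_lt_card
  set D := ∑ i, j i with hD
  set C' := 2 * q * (d + 1) * (D + 1) + 1 with hC'
  set B : ℕ := d * (C' + D + 1) + Fintype.card ι with hB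
  set n0 := Fintype.card ι + 2 * (d * (2 * D + 3) + 1) + 2 * (2 * C') + 2 with hn0
  have hsq : (1 : ℝ) ≤ Real.sqrt q := by
    rw [Real.one_le_sqrt]; exact_mod_cast hq1.le
  have hmod : ∀ k, q ^ k % d = 1 := by
    intro k
    rw [Nat.pow_mod, hq, one_pow, Nat.mod_eq_of_lt (by omega)]
  have hmod' : ∀ k, q ^ k = d * (q ^ k / d) + 1 := by
    intro k
    have := Nat.div_add_mod (q ^ k) d
    rw [hmod k] at this
    exact this.symm
  have hlarge : ∀ r, n0 ≤ r → ‖∑ x : K r, lamb χ a j (cpol F x)‖ ≤ B * Real.sqrt q ^ (r + 1) := by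
    intro r hr
    have hcK : Fintype.card (K r) = q ^ (r + 1) := by
      rw [Module.card_eq_pow_finrank (K := F), hK]
    have : CharP (K r) p := charP_of_injective_algebraMap (algebraMap F (K r)).injective p
    simp_rw [lamb_cpol]
    have hlt : ∀ k, k < q ^ k := fun k => Nat.lt_pow_self hq1
    have hsplit : (r + 1) = (r + 1) / 2 + (r + 1 - (r + 1) / 2) := by omega
    have hb := char_sum_bound p (fun i => algebraMap F (K r) (a i))
      ((algebraMap F (K r)).injective.comp ha) (by rw [hcK]; have := hlt (r + 1); omega) j d hd hj
      (s0 * ((r + 1) / 2)) (q ^ ((r + 1) / 2) / d) (q ^ ((r + 1) / 2)) (by rw [pow_mul, ← hs0])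
      (hmod' _)
      (s0 * (r + 1 - (r + 1) / 2)) (q ^ (r + 1 - (r + 1) / 2) / d) (q ^ (r + 1 - (r + 1) / 2))
      (by rw [pow_mul, ← hs0]) (hmod' _) (by rw [hcK, ← pow_add, ← hsplit]) q
      (by
        rw [← pow_succ']
        exact Nat.pow_le_pow_right hq1.le (by omega)) D C' hD.symm hC'
      (by
        rw [Nat.le_div_iff_mul_le (by omega)]
        have := hlt ((r + 1) / 2)
        rw [mul_comm]; omega)
      (by have := hlt (r + 1 - (r + 1) / 2); omega)
      (normChar (K r) χ) (by rw [orderOf_normChar, hχ])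
    refine hb.trans ?_
    have hQ : ((q ^ ((r + 1) / 2) : ℕ) : ℝ) ≤ Real.sqrt q ^ (r + 1) := by
      have : ((q ^ ((r + 1) / 2) : ℕ) : ℝ) = Real.sqrt q ^ (2 * ((r + 1) / 2)) := by
        rw [pow_mul, Real.sq_sqrt (Nat.cast_nonneg _)]; push_cast; rfl
      rw [this]
      exact pow_le_pow_right₀ hsq (by omega)
    have hone : (1 : ℝ) ≤ Real.sqrt q ^ (r + 1) := one_le_pow₀ hsq
    have e1 : (B : ℝ) = (d * (C' + D + 1)) + Fintype.card ι := by rw [hB]; push_cast; ring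
    rw [e1, add_mul]
    have hnn : (0 : ℝ) ≤ d * (C' + D + 1) := by positivity
    have hnn2 : (0 : ℝ) ≤ Fintype.card ι := by positivity
    have t1 := mul_le_mul_of_nonneg_right hQ hnn
    have t2 := mul_le_mul_of_nonneg_left hone hnn2
    linarith
  refine ⟨B * Real.sqrt q + ∑ r ∈ Finset.range n0, ‖∑ x : K r, lamb χ a j (cpol F x)‖, fun r => ?_⟩
  have hpos : (0 : ℝ) ≤ ∑ r ∈ Finset.range n0, ‖∑ x : K r, lamb χ a j (cpol F x)‖ :=
    Finset.sum_nonneg fun _ _ => norm_nonneg _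
  have hone : (1 : ℝ) ≤ Real.sqrt q ^ r := one_le_pow₀ hsq
  rcases lt_or_ge r n0 with h | h
  · have h1 := Finset.single_le_sum (f := fun r => ‖∑ x : K r, lamb χ a j (cpol F x)‖)
      (fun _ _ => norm_nonneg _) (Finset.mem_range.2 h)
    have h2 : (0 : ℝ) ≤ B * Real.sqrt q := by positivity
    nlinarith
  · have h1 := hlarge r h
    rw [pow_succ] at h1
    have h3 := mul_nonneg hpos (zero_le_one.trans hone)
    rw [add_mul]
    nlinarith

end

section
open Polynomial

lemma hasSum_eval (Q : ℂ[X]) (z : ℂ) : HasSum (fun n => Q.coeff n * z ^ n) (Q.eval z) := by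
  rw [eval_eq_sum_range]
  apply hasSum_sum_of_ne_finset_zero
  intro n hn
  rw [Finset.mem_range] at hn
  rw [coeff_eq_zero_of_natDegree_lt (by omega), zero_mul]

lemma summable_norm_eval (Q : ℂ[X]) (z : ℂ) : Summable (fun n => ‖Q.coeff n * z ^ n‖) := by
  apply summable_of_ne_finset_zero (s := Finset.range (Q.natDegree + 1))
  intro n hn
  rw [Finset.mem_range] at hn
  rw [coeff_eq_zero_of_natDegree_lt (by omega), zero_mul, norm_zero]

lemma eval_of_ps_mul (P Q : ℂ[X]) (S : ℕ → ℂ) (z : ℂ) (hS : Summable fun n => ‖S n * z ^ n‖)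
    (h : (P : PowerSeries ℂ) = PowerSeries.mk S * (Q : PowerSeries ℂ)) (hQ : Q.eval z = 0) : P.eval z = 0 := by
  have h1 := tsum_mul_tsum_eq_tsum_sum_antidiagonal_of_summable_norm hS (summable_norm_eval Q z)
  rw [(hasSum_eval Q z).tsum_eq, hQ, mul_zero] at h1
  rw [← (hasSum_eval P z).tsum_eq, h1]
  congr 1
  ext n
  have h2 := congrArg (PowerSeries.coeff n) h
  rw [Polynomial.coeff_coe, PowerSeries.coeff_mul] at h2
  rw [h2, Finset.sum_mul]
  refine Finset.sum_congr rfl fun kl hkl => ?_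
  rw [PowerSeries.coeff_mk, Polynomial.coeff_coe, ← Finset.HasAntidiagonal.mem_antidiagonal.1 hkl, pow_add]
  ring

lemma analytic_bound (c S : ℕ → ℂ) (m : ℕ) (hm : 1 ≤ m) (c0 : c 0 = 1) (hc : ∀ n, m ≤ n → c n = 0)
    (hN : ∀ n : ℕ, (n : ℂ) * c n = ∑ r ∈ Finset.range n, S r * c (n - 1 - r))
    (A s : ℝ) (hs : 0 < s) (hS : ∀ r, ‖S r‖ ≤ A * s ^ r) : ‖c 1‖ ≤ (m - 1) * s := by
  set L : ℂ[X] := ∑ n ∈ Finset.range m, monomial n (c n) with hL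
  have hLc : ∀ n, L.coeff n = c n := by
    intro n
    rw [hL, finsetSum_coeff]
    simp only [coeff_monomial]
    rw [Finset.sum_ite_eq']
    split_ifs with h
    · rfl
    · rw [Finset.mem_range] at h
      exact (hc n (by omega)).symm
  have hLdeg : L.natDegree ≤ m - 1 := by
    rw [natDegree_le_iff_coeff_eq_zero]
    intro n hn
    rw [hLc, hc n (by omega)]
  have hL0 : L ≠ 0 := by
    intro h
    have := hLc 0
    rw [h, c0] at this
    simp at this
  have hps : ((derivative L : ℂ[X]) : PowerSeries ℂ) = PowerSeries.mk S * (L : PowerSeries ℂ) := by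
    ext n
    rw [Polynomial.coeff_coe, coeff_derivative, PowerSeries.coeff_mul,
      Finset.Nat.sum_antidiagonal_eq_sum_range_succ_mk]
    simp only [PowerSeries.coeff_mk, Polynomial.coeff_coe, hLc]
    have := hN (n + 1)
    simp only [Nat.add_sub_cancel] at this
    rw [← this]
    push_cast
    ring
  have hroot : ∀ z : ℂ, L.eval z = 0 → 1 ≤ s * ‖z‖ := by
    intro z hz
    by_contra hlt
    push Not at hlt
    have hsum : Summable fun n => ‖S n * z ^ n‖ := by
      refine Summable.of_nonneg_of_le (fun _ => norm_nonneg _) (fun n => ?_)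
        ((summable_geometric_of_lt_one (by positivity) hlt).mul_left A)
      rw [norm_mul, norm_pow, mul_pow, ← mul_assoc]
      exact mul_le_mul_of_nonneg_right (hS n) (by positivity)
    obtain ⟨L1, hL1, hnd⟩ := exists_eq_pow_rootMultiplicity_mul_and_not_dvd L hL0 z
    have hk : 0 < L.rootMultiplicity z := (rootMultiplicity_pos hL0).2 hz
    obtain ⟨k, hk⟩ : ∃ k, L.rootMultiplicity z = k + 1 := ⟨_, (Nat.succ_pred_eq_of_pos hk).symm⟩
    rw [hk] at hL1
    have hder : derivative L = (X - C z) ^ k * (C ((k : ℂ) + 1) * L1 + (X - C z) * derivative L1) := by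
      rw [hL1, derivative_mul, derivative_pow]
      simp
      ring
    have hL2 : L = (X - C z) ^ k * ((X - C z) * L1) := by
      rw [hL1, pow_succ]; ring
    rw [hder, hL2, Polynomial.coe_mul, Polynomial.coe_mul ((X - C z) ^ k)] at hps
    have hne : (((X - C z) ^ k : ℂ[X]) : PowerSeries ℂ) ≠ 0 := by
      rw [Ne, Polynomial.coe_eq_zero_iff]
      exact pow_ne_zero _ (X_sub_C_ne_zero z)
    rw [mul_left_comm] at hps
    have hps2 := mul_left_cancel₀ hne hps
    have := eval_of_ps_mul _ _ S z hsum hps2 (by simp)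
    simp only [eval_add, eval_mul, eval_C, eval_sub, eval_X, sub_self, zero_mul, add_zero] at this
    rcases mul_eq_zero.1 this with h | h
    · have h' : ((k + 1 : ℕ) : ℂ) = 0 := by push_cast; exact h
      exact absurd (Nat.cast_eq_zero.1 h') (by omega)
    · exact hnd (dvd_iff_isRoot.2 h)
  have hm1 : (0 : ℝ) ≤ m - 1 := by
    have : (1 : ℝ) ≤ m := by exact_mod_cast hm
    linarith
  have htr : L.natTrailingDegree = 0 := by
    rw [natTrailingDegree_eq_zero]
    right; rw [hLc, c0]; exact one_ne_zero
  have hrd : L.reverse.natDegree = L.natDegree := by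
    rw [reverse_natDegree, htr, Nat.sub_zero]
  have hmon : L.reverse.Monic := by
    rw [Monic, reverse_leadingCoeff, trailingCoeff, htr, hLc, c0]
  have hnext : L.reverse.nextCoeff = c 1 := by
    rw [nextCoeff, hrd]
    split_ifs with h
    · rw [← hLc, coeff_eq_zero_of_natDegree_lt (by omega)]
    · rw [coeff_reverse, revAt_le (by omega), ← hLc]
      congr 1; omega
  have hω : ∀ w ∈ L.reverse.roots, ‖w‖ ≤ s := by
    intro w hw
    have hw := (mem_roots'.1 hw).2
    have hw0 : w ≠ 0 := by
      rintro rfl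
      rw [IsRoot, ← coeff_zero_eq_eval_zero, coeff_zero_reverse] at hw
      exact hL0 (leadingCoeff_eq_zero.1 hw)
    have : Invertible w⁻¹ := invertibleOfNonzero (inv_ne_zero hw0)
    have h1 := (eval₂_reverse_eq_zero_iff (RingHom.id ℂ) w⁻¹ L).1 (by
      rw [invOf_eq_inv, inv_inv]; exact hw)
    have h2 := hroot w⁻¹ h1
    rw [norm_inv, ← div_eq_mul_inv, one_le_div (norm_pos_iff.2 hw0)] at h2
    exact h2
  rw [← hnext, (IsAlgClosed.splits L.reverse).nextCoeff_eq_neg_sum_roots_of_monic hmon, norm_neg]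
  have h3 : ‖L.reverse.roots.sum‖ ≤ (L.reverse.roots.map fun w => ‖w‖).sum := norm_multiset_sum_le _
  have h4 : (L.reverse.roots.map fun w => ‖w‖).sum ≤ (L.reverse.roots.map fun w => ‖w‖).card • s := by
    apply Multiset.sum_le_card_nsmul
    intro x hx
    obtain ⟨w, hw, rfl⟩ := Multiset.mem_map.1 hx
    exact hω w hw
  rw [Multiset.card_map, nsmul_eq_mul] at h4
  have h5 : (L.reverse.roots.card : ℝ) ≤ m - 1 := by
    have h6 : L.reverse.roots.card ≤ m - 1 := (card_roots' _).trans (by rw [hrd]; exact hLdeg)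
    have h7 : L.reverse.roots.card + 1 ≤ m := by omega
    have h8 : ((L.reverse.roots.card : ℝ) + 1) ≤ m := by exact_mod_cast h7
    linarith
  exact h3.trans (h4.trans (mul_le_mul_of_nonneg_right h5 hs.le))

end

section
open Polynomial

lemma weil0 {F : Type*} [Field F] [Fintype F] {ι : Type*} [Fintype ι]
    (a : ι → F) (ha : Function.Injective a) (j : ι → ℕ) (d : ℕ) (hd : 2 ≤ d)
    (hj : ∀ r : ℕ, (∀ i, d ∣ r * j i) → d ∣ r) (hq : Fintype.card F % d = 1)
    (χ : MulChar F ℂ) (hχ : orderOf χ = d) :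
    ‖∑ x, ∏ i, χ (x + a i) ^ j i‖ ≤ ((Fintype.card ι : ℝ) - 1) * Real.sqrt (Fintype.card F) := by
  obtain ⟨p, hp⟩ := CharP.exists F
  have hpp : Fact p.Prime := ⟨CharP.char_is_prime F p⟩
  obtain ⟨i0, hi0⟩ : ∃ i0, ¬ d ∣ j i0 := by
    by_contra h
    push Not at h
    have := hj 1 (fun i => by rw [one_mul]; exact h i)
    have := Nat.le_of_dvd one_pos this
    omega
  let K : ℕ → Type := fun r => FiniteField.Extension F p (r + 1)
  let _ : ∀ r, Field (K r) := fun r => inferInstanceAs (Field (FiniteField.Extension F p (r + 1)))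
  let _ : ∀ r, Fintype (K r) := fun r => Fintype.ofFinite (FiniteField.Extension F p (r + 1))
  let _ : ∀ r, Algebra F (K r) := fun r => inferInstanceAs (Algebra F (FiniteField.Extension F p (r + 1)))
  have hK : ∀ r, Module.finrank F (K r) = r + 1 := fun r => FiniteField.finrank_extension F p (r + 1)
  obtain ⟨A, hA⟩ := S_bound p K hK a ha j d hd hj hq χ hχ
  rw [← sum_lamb_one]
  refine analytic_bound (fun n => ∑ g ∈ monics F n, lamb χ a j g)
    (fun r => ∑ x : K r, lamb χ a j (cpol F x)) (Fintype.card ι) ?_ ?_ ?_ ?_ A _ ?_ hA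
  · exact Fintype.card_pos_iff.2 ⟨i0⟩
  · exact sum_lamb_zero χ a j
  · intro n hn
    refine sum_lamb_large χ a ha j i0 ?_ n hn
    intro h
    rw [← hχ] at hi0
    exact hi0 (orderOf_dvd_of_pow_eq_one h)
  · exact newton K _ (lamb_mul χ a j) hK
  · rw [Real.sqrt_pos]; exact_mod_cast Fintype.card_pos

lemma weil {F : Type*} [Field F] [Fintype F] {ι : Type*} [Fintype ι] [Nonempty ι]
    (a : ι → F) (ha : Function.Injective a) (j : ι → ℕ) (d : ℕ) (hd : 2 ≤ d)
    (hj : ∀ i, 0 < j i ∧ j i < d) (hq : Fintype.card F % d = 1)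
    (χ : MulChar F ℂ) (hχ : orderOf χ = d) :
    ‖∑ x, ∏ i, χ (x + a i) ^ j i‖ ≤ ((Fintype.card ι : ℝ) - 1) * Real.sqrt (Fintype.card F) := by
  classical
  set g := Nat.gcd d (Finset.univ.gcd j) with hg
  have hgd : g ∣ d := Nat.gcd_dvd_left _ _
  have hgj : ∀ i, g ∣ j i := fun i => (Nat.gcd_dvd_right _ _).trans (Finset.gcd_dvd (Finset.mem_univ i))
  have hg0 : 0 < g := Nat.gcd_pos_of_pos_left _ (by omega)
  obtain ⟨i0⟩ := ‹Nonempty ι›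
  have hgle : g ≤ j i0 := Nat.le_of_dvd (hj i0).1 (hgj i0)
  have hglt : g < d := hgle.trans_lt (hj i0).2
  obtain ⟨d', hd'⟩ := hgd
  choose j' hj' using hgj
  have hd'2 : 2 ≤ d' := by
    by_contra h
    have : d' ≤ 1 := by omega
    nlinarith
  have hord : orderOf (χ ^ g) = d' := by
    rw [orderOf_pow_of_dvd hg0.ne' (by rw [hχ]; exact ⟨d', hd'⟩), hχ, hd', Nat.mul_div_cancel_left _ hg0]
  have hq' : Fintype.card F % d' = 1 := by
    have h1 : Fintype.card F ≡ 1 [MOD d] := by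
      rw [Nat.ModEq, hq, Nat.mod_eq_of_lt (by omega)]
    have h2 : Fintype.card F ≡ 1 [MOD d'] := h1.of_dvd ⟨g, by rw [hd', mul_comm]⟩
    rw [Nat.ModEq, Nat.mod_eq_of_lt (a := 1) (by omega)] at h2
    exact h2
  have := weil0 a ha j' d' hd'2 ?_ hq' (χ ^ g) hord
  · refine le_trans (le_of_eq ?_) this
    congr 1
    refine Finset.sum_congr rfl fun x _ => Finset.prod_congr rfl fun i _ => ?_
    rw [MulChar.pow_apply' χ hg0.ne', ← pow_mul, ← hj' i]
  · intro r hr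
    have h1 : ∀ i, d ∣ r * j i := by
      intro i
      rw [hj' i, mul_left_comm]
      conv_lhs => rw [hd']
      exact Nat.mul_dvd_mul_left g (hr i)
    have h2 : d ∣ r * Finset.univ.gcd j := by
      have : r * Finset.univ.gcd j = Finset.univ.gcd (fun i => r * j i) := by
        rw [Finset.gcd_mul_left]; simp
      rw [this]
      exact Finset.dvd_gcd fun i _ => h1 i
    have h3 : d ∣ r * g := by
      rw [hg, ← Nat.gcd_mul_left]
      exact Nat.dvd_gcd (dvd_mul_left d r) h2
    conv_lhs at h3 => rw [hd']
    rw [mul_comm r g] at h3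
    exact Nat.dvd_of_mul_dvd_mul_left hg0 h3

end

section
open Polynomial

section
variable {F : Type*} [Field F] [Fintype F]

/-- indicator function expansion -/
noncomputable def indf (d : ℕ) (χ : MulChar F ℂ) (e : ℂ) (y : F) : ℂ :=
  (d : ℂ)⁻¹ * ∑ l ∈ Finset.range d, (e⁻¹) ^ l * χ y ^ l

lemma indf_zero (d : ℕ) (hd : 2 ≤ d) (χ : MulChar F ℂ) (e : ℂ) : indf d χ e 0 = (d : ℂ)⁻¹ := by
  unfold indf
  rw [χ.map_zero]
  obtain ⟨d, rfl⟩ : ∃ d', d = d' + 1 := ⟨d - 1, by omega⟩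
  rw [Finset.sum_range_succ']
  simp

lemma indf_of_eq (d : ℕ) (hd : 2 ≤ d) (χ : MulChar F ℂ) (e : ℂ) (he : e ^ d = 1) (y : F) (h : χ y = e) :
    indf d χ e y = 1 := by
  have he0 : e ≠ 0 := by
    rintro rfl
    rw [zero_pow (by omega)] at he
    exact zero_ne_one he
  unfold indf
  rw [h]
  have : ∀ l, (e⁻¹) ^ l * e ^ l = 1 := fun l => by rw [← mul_pow, inv_mul_cancel₀ he0, one_pow]
  simp_rw [this]
  have hd0 : (d : ℂ) ≠ 0 := by exact_mod_cast (by omega)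
  simp [hd0]

lemma indf_of_ne (d : ℕ) (hd : 2 ≤ d) (χ : MulChar F ℂ) (hχ : orderOf χ = d) (e : ℂ) (he : e ^ d = 1)
    (y : F) (hy : y ≠ 0) (h : χ y ≠ e) :
    indf d χ e y = 0 := by
  have he0 : e ≠ 0 := by
    rintro rfl
    rw [zero_pow (by omega)] at he
    exact zero_ne_one he
  have hyd : χ y ^ d = 1 := by
    have h1 : χ ^ d = 1 := by rw [← hχ]; exact pow_orderOf_eq_one χ
    rw [← MulChar.pow_apply' χ (by omega), h1, MulChar.one_apply (IsUnit.mk0 y hy)]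
  unfold indf
  simp_rw [← mul_pow]
  have hne : e⁻¹ * χ y ≠ 1 := by
    intro h2
    apply h
    field_simp at h2
    exact h2
  rw [geom_sum_eq hne, mul_pow, inv_pow, he, hyd]
  simp

lemma indf_norm_le (d : ℕ) (hd : 2 ≤ d) (χ : MulChar F ℂ) (hχ : orderOf χ = d) (e : ℂ) (he : e ^ d = 1)
    (y : F) : ‖indf d χ e y‖ ≤ 1 := by
  by_cases hy : y = 0
  · subst hy
    rw [indf_zero d hd, norm_inv, Complex.norm_natCast]
    exact inv_le_one_of_one_le₀ (by exact_mod_cast (by omega))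
  · by_cases h : χ y = e
    · rw [indf_of_eq d hd χ e he y h, norm_one]
    · rw [indf_of_ne d hd χ hχ e he y hy h, norm_zero]; exact zero_le_one

lemma sum_card (d : ℕ) (hd : 2 ≤ d) (k : ℕ) :
    ∑ l ∈ Fintype.piFinset (fun _ : Fin k => Finset.range d), (Fintype.card {i // l i ≠ 0} : ℝ) =
      d ^ k * (k * (((d : ℝ) - 1) / d)) := by
  have hd0 : (d : ℝ) ≠ 0 := by exact_mod_cast (by omega)
  have h1 : ∀ l : Fin k → ℕ, (Fintype.card {i // l i ≠ 0} : ℝ) = ∑ i, if l i ≠ 0 then 1 else 0 := by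
    intro l
    rw [Fintype.card_subtype, Finset.card_filter]
    push_cast
    rfl
  simp_rw [h1]
  rw [Finset.sum_comm]
  have h2 : ∀ i : Fin k, ∑ l ∈ Fintype.piFinset (fun _ : Fin k => Finset.range d),
      (if l i ≠ 0 then (1 : ℝ) else 0) = d ^ k * (((d : ℝ) - 1) / d) := by
    intro i
    have h3 : ∀ l : Fin k → ℕ, (if l i ≠ 0 then (1 : ℝ) else 0) =
        ∏ i', (if i = i' then (if l i' ≠ 0 then (1 : ℝ) else 0) else 1) := by
      intro l
      rw [Finset.prod_ite_eq]
      simp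
    simp_rw [h3]
    rw [← Finset.prod_univ_sum (fun _ : Fin k => Finset.range d)
      (fun i' t => if i = i' then (if t ≠ 0 then (1 : ℝ) else 0) else 1)]
    have h4 : ∀ i' : Fin k, ∑ t ∈ Finset.range d, (if i = i' then (if t ≠ 0 then (1 : ℝ) else 0) else 1)
        = d * (if i = i' then ((d : ℝ) - 1) / d else 1) := by
      intro i'
      split_ifs with h
      · obtain ⟨d, rfl⟩ : ∃ d', d = d' + 1 := ⟨d - 1, by omega⟩
        rw [Finset.sum_range_succ']
        field_simp
        simp
      · simp
    simp_rw [h4]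
    rw [Finset.prod_mul_distrib, Finset.prod_ite_eq]
    simp
  simp_rw [h2]
  simp
  ring

lemma weil_tuple (d : ℕ) (hd : 2 ≤ d) (hq : Fintype.card F % d = 1)
    (χ : MulChar F ℂ) (hχ : orderOf χ = d) (k : ℕ) (a : Fin k → F) (ha : Function.Injective a)
    (l : Fin k → ℕ) (hl : ∀ i, l i < d) (hl0 : l ≠ 0) :
    ‖∑ x, ∏ i, χ (x + a i) ^ l i‖ ≤ ((Fintype.card {i // l i ≠ 0} : ℝ) - 1) * Real.sqrt (Fintype.card F) := by
  have hne : Nonempty {i // l i ≠ 0} := by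
    by_contra h
    apply hl0
    ext i
    by_contra hi
    exact h ⟨i, hi⟩
  have := weil (fun i : {i // l i ≠ 0} => a i) (ha.comp Subtype.val_injective) (fun i => l i) d hd
    (fun i => ⟨Nat.pos_of_ne_zero i.2, hl i⟩) hq χ hχ
  refine le_trans (le_of_eq ?_) this
  congr 1
  refine Finset.sum_congr rfl fun x _ => ?_
  have h1 : ∏ i, χ (x + a i) ^ l i = ∏ i ∈ Finset.univ.filter (fun i => l i ≠ 0), χ (x + a i) ^ l i := by
    rw [Finset.prod_filter]
    refine Finset.prod_congr rfl fun i _ => ?_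
    split_ifs with h
    · rfl
    · push Not at h
      rw [h, pow_zero]
  rw [h1]
  exact Finset.prod_subtype _ (by simp) (fun i => χ (x + a i) ^ l i)

lemma main_sum (d : ℕ) (hd : 2 ≤ d) (hq : Fintype.card F % d = 1)
    (χ : MulChar F ℂ) (hχ : orderOf χ = d) (k : ℕ) (a : Fin k → F) (ha : Function.Injective a)
    (ε : Fin k → ℂ) (hε : ∀ i, ε i ^ d = 1) :
    ‖∑ x, ∏ i, indf d χ (ε i) (x + a i) - (Fintype.card F : ℂ) / d ^ k‖ ≤
      ((k : ℝ) - 1 - k / d + 1 / d ^ k) * Real.sqrt (Fintype.card F) := by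
  classical
  have hd0 : (d : ℝ) ≠ 0 := by exact_mod_cast (by omega)
  set P := Fintype.piFinset (fun _ : Fin k => Finset.range d) with hP
  have h0P : (0 : Fin k → ℕ) ∈ P := by
    rw [hP, Fintype.mem_piFinset]
    intro i; rw [Finset.mem_range]; exact (by omega : 0 < d)
  have hPcard : (P.card : ℝ) = d ^ k := by
    rw [hP, Fintype.card_piFinset]; simp
  set T : (Fin k → ℕ) → ℂ := fun l => (∏ i, ((ε i)⁻¹) ^ l i) * ∑ x, ∏ i, χ (x + a i) ^ l i with hT
  have h1 : ∑ x, ∏ i, indf d χ (ε i) (x + a i) = ((d : ℂ) ^ k)⁻¹ * ∑ l ∈ P, T l := by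
    simp_rw [hT, Finset.mul_sum]
    rw [Finset.sum_comm]
    refine Finset.sum_congr rfl fun x _ => ?_
    unfold indf
    rw [Finset.prod_mul_distrib, Finset.prod_univ_sum, Finset.prod_const, Finset.card_univ,
      Fintype.card_fin, inv_pow, Finset.mul_sum]
    refine Finset.sum_congr rfl fun l _ => ?_
    rw [Finset.prod_mul_distrib]
  have h2 : T 0 = Fintype.card F := by simp [hT]
  rw [h1, ← Finset.add_sum_erase _ _ h0P, h2, mul_add, div_eq_inv_mul, add_sub_cancel_left, norm_mul]
  have h3 : ‖∑ l ∈ P.erase 0, T l‖ ≤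
      ∑ l ∈ P.erase 0, ((Fintype.card {i // l i ≠ 0} : ℝ) - 1) * Real.sqrt (Fintype.card F) := by
    refine (norm_sum_le _ _).trans (Finset.sum_le_sum fun l hl => ?_)
    rw [Finset.mem_erase, hP, Fintype.mem_piFinset] at hl
    have h4 : ‖∏ i, ((ε i)⁻¹) ^ l i‖ = 1 := by
      rw [norm_prod]
      refine Finset.prod_eq_one fun i _ => ?_
      rw [norm_pow, norm_inv, Complex.norm_eq_one_of_pow_eq_one (hε i) (by omega), inv_one, one_pow]
    rw [hT]
    simp only
    rw [norm_mul, h4, one_mul]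
    exact weil_tuple d hd hq χ hχ k a ha l (fun i => Finset.mem_range.1 (hl.2 i)) hl.1
  have h5 : ∑ l ∈ P.erase 0, ((Fintype.card {i // l i ≠ 0} : ℝ) - 1) =
      d ^ k * (k * (((d : ℝ) - 1) / d)) - d ^ k + 1 := by
    have h6 := Finset.add_sum_erase P (fun l => ((Fintype.card {i // l i ≠ 0} : ℝ) - 1)) h0P
    have h6' : ∑ l ∈ P, ((Fintype.card {i // l i ≠ 0} : ℝ) - 1) =
        d ^ k * (k * (((d : ℝ) - 1) / d)) - d ^ k := by
      rw [Finset.sum_sub_distrib, hP, sum_card d hd k, ← hP]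
      simp only [Finset.sum_const, nsmul_eq_mul, mul_one, hPcard]
    rw [h6'] at h6
    have h7 : (Fintype.card {i : Fin k // (0 : Fin k → ℕ) i ≠ 0} : ℝ) = 0 := by simp
    rw [h7] at h6
    linarith
  rw [← Finset.sum_mul, h5] at h3
  have h8 : ‖((d : ℂ) ^ k)⁻¹‖ = ((d : ℝ) ^ k)⁻¹ := by simp
  rw [h8]
  refine (mul_le_mul_of_nonneg_left h3 (by positivity)).trans (le_of_eq ?_)
  field_simp
  ring
end

end

theorem character_conditions_count
    (d : ℕ) (hd : 2 ≤ d) (F : Type*) [Field F] [Fintype F]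
    (hq : Fintype.card F % d = 1)
    (χ : MulChar F ℂ) (hχ : orderOf χ = d)
    (k : ℕ) (hk : 1 ≤ k) (a : Fin k → F) (ha : Function.Injective a)
    (ε : Fin k → ℂ) (hε : ∀ i, ε i ^ d = 1) :
    |(Nat.card {x : F // ∀ i, χ (x + a i) = ε i} : ℝ) -
        (Fintype.card F : ℝ) / d ^ k| ≤
      ((k : ℝ) - 1 - k / d + 1 / d ^ k) * Real.sqrt (Fintype.card F) + k / d := by
  classical
  have hmain := main_sum d hd hq χ hχ k a ha ε hε
  have hN : (Nat.card {x : F // ∀ i, χ (x + a i) = ε i} : ℂ) =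
      ∑ x : F, if ∀ i, χ (x + a i) = ε i then (1 : ℂ) else 0 := by
    rw [Nat.card_eq_fintype_card, Fintype.card_subtype, Finset.card_filter]
    push_cast
    rfl
  have hx : ∀ x : F, ‖(if ∀ i, χ (x + a i) = ε i then (1 : ℂ) else 0) -
      ∏ i, indf d χ (ε i) (x + a i)‖ ≤ if x ∈ Finset.univ.image (fun i => - a i) then (d : ℝ)⁻¹ else 0 := by
    intro x
    split_ifs with h1 h2 h2
    · obtain ⟨i, _, rfl⟩ := Finset.mem_image.1 h2
      exfalso
      have h3 := h1 i
      rw [neg_add_cancel, χ.map_zero] at h3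
      have h4 := hε i
      rw [← h3, zero_pow (by omega)] at h4
      exact zero_ne_one h4
    · rw [Finset.prod_eq_one fun i _ => indf_of_eq d hd χ _ (hε i) _ (h1 i)]
      simp
    · obtain ⟨i, _, rfl⟩ := Finset.mem_image.1 h2
      rw [zero_sub, norm_neg, norm_prod, ← Finset.mul_prod_erase _ _ (Finset.mem_univ i)]
      rw [neg_add_cancel, indf_zero d hd, norm_inv, Complex.norm_natCast]
      refine mul_le_of_le_one_right (by positivity) ?_
      exact Finset.prod_le_one (fun _ _ => norm_nonneg _)
        (fun i' _ => indf_norm_le d hd χ hχ _ (hε i') _)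
    · push Not at h1
      obtain ⟨i, hi⟩ := h1
      rw [Finset.prod_eq_zero (Finset.mem_univ i)]
      · simp
      · refine indf_of_ne d hd χ hχ _ (hε i) _ ?_ hi
        intro h
        apply h2
        exact Finset.mem_image.2 ⟨i, Finset.mem_univ i, (eq_neg_of_add_eq_zero_left h).symm⟩
  have hE : ‖(Nat.card {x : F // ∀ i, χ (x + a i) = ε i} : ℂ) -
      ∑ x, ∏ i, indf d χ (ε i) (x + a i)‖ ≤ k / d := by
    rw [hN, ← Finset.sum_sub_distrib]
    refine (norm_sum_le _ _).trans ((Finset.sum_le_sum fun x _ => hx x).trans ?_)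
    rw [← Finset.sum_filter, Finset.sum_const, nsmul_eq_mul, div_eq_mul_inv]
    refine mul_le_mul_of_nonneg_right ?_ (by positivity)
    have h1 : (Finset.univ.filter fun x => x ∈ Finset.univ.image (fun i => - a i)).card ≤ k := by
      rw [Finset.filter_mem_eq_inter, Finset.univ_inter]
      exact Finset.card_image_le.trans (by simp)
    exact_mod_cast h1
  have hfin : ‖(Nat.card {x : F // ∀ i, χ (x + a i) = ε i} : ℂ) - (Fintype.card F : ℂ) / d ^ k‖ ≤
      ((k : ℝ) - 1 - k / d + 1 / d ^ k) * Real.sqrt (Fintype.card F) + k / d := by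
    have := norm_sub_le_norm_sub_add_norm_sub (Nat.card {x : F // ∀ i, χ (x + a i) = ε i} : ℂ)
      (∑ x, ∏ i, indf d χ (ε i) (x + a i)) ((Fintype.card F : ℂ) / d ^ k)
    linarith
  rw [← Real.norm_eq_abs, ← Complex.norm_real]
  push_cast
  exact hfin
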